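/- arXiv:2003.10320 — 3 statements merged into one kernel-verified Lean document; each statement's English description precedes it below -/
import Mathlib

section
/- Let 𝒦 ⊆ 𝒞 be a family such that for every P ∈ 𝒦 and z ∈ ℂ, the measure P_z is supported on paths X with X_0 = z, and suppose: (1) (equicontinuity of laws) for every L > 1 there exists δ = δ(L) > 0 such that for every P ∈ 𝒦 and all z, w ∈ B_L(0) with |z − w| ≤ δ, d_Prok(P_z, P_w) ≤ 1/L; and (2) (equicontinuity of paths) for every L > 0 and every z ∈ ℂ there exists δ = δ(z, L) > 0 such that for every P ∈ 𝒦, a path X sampled from P_z satisfies, with probability at least 1 − 1/L, |X_s − X_t| ≤ 1/L for all s, t ∈ [0, L] with |s − t| ≤ δ. Then 𝒦 is pre-compact, i.e., the closure of 𝒦 in 𝒞 is compact. -/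
open MeasureTheory Topology
open scoped ENNReal NNReal

noncomputable section

/-- The space `C([0,∞), ℂ)` of continuous paths, with the topology of uniform convergence
on compact time intervals (= the compact-open topology). -/
abbrev PathSp : Type := C(ℝ≥0, ℂ)

instance : MeasurableSpace PathSp := borel PathSp

/-- The distance function of a given metric-space structure `dM` on path space. -/
def pdist (dM : MetricSpace PathSp) : PathSp → PathSp → ℝ :=
  letI := dM
  dist

/-- The open `ε`-thickening of a set of paths, w.r.t. the metric `dM`. -/
def thick (dM : MetricSpace PathSp) (ε : ℝ) (A : Set PathSp) : Set PathSp :=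
  {g | ∃ f ∈ A, pdist dM f g < ε}

/-- The Lévy–Prokhorov distance on Borel probability measures on path space induced by the
metric `dM`. -/
def prokDist (dM : MetricSpace PathSp) (μ ν : ProbabilityMeasure PathSp) : ℝ :=
  sInf {ε : ℝ | 0 < ε ∧ ∀ A : Set PathSp, MeasurableSet A →
    ((μ : Measure PathSp) A ≤ (ν : Measure PathSp) (thick dM ε A) + ENNReal.ofReal ε ∧
      (ν : Measure PathSp) A ≤ (μ : Measure PathSp) (thick dM ε A) + ENNReal.ofReal ε)}

/-- The topology on `Prob(C([0,∞), ℂ))` induced by the Lévy–Prokhorov metric. -/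
def prokTop (dM : MetricSpace PathSp) : TopologicalSpace (ProbabilityMeasure PathSp) :=
  TopologicalSpace.generateFrom
    {s | ∃ (μ : ProbabilityMeasure PathSp) (ε : ℝ), 0 < ε ∧
      s = {ν | prokDist dM μ ν < ε}}

/-- The space `𝒞` of continuous maps `ℂ → Prob(C([0,∞), ℂ))`. -/
def CSp (dM : MetricSpace PathSp) : Type :=
  {P : ℂ → ProbabilityMeasure PathSp //
    @Continuous ℂ (ProbabilityMeasure PathSp) inferInstance (prokTop dM) P}

/-- The topology on `𝒞` of uniform convergence on compact subsets of `ℂ`. -/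
def CTop (dM : MetricSpace PathSp) : TopologicalSpace (CSp dM) :=
  TopologicalSpace.generateFrom
    {s | ∃ (P : CSp dM) (K : Set ℂ) (ε : ℝ), IsCompact K ∧ 0 < ε ∧
      s = {Q | ∀ z ∈ K, prokDist dM (P.1 z) (Q.1 z) < ε}}

/-- The **Arzelà–Ascoli theorem** in the compact-open topology, for an equicontinuous family of
continuous maps which is pointwise relatively compact. -/
theorem isCompact_closure_of_equicontinuous {X α : Type*} [TopologicalSpace X]
    [CompactlyCoherentSpace X] [UniformSpace α] [T2Space α] {s : Set C(X, α)}
    (hs : Equicontinuous (fun (f : s) (x : X) ↦ (f : C(X, α)) x))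
    (hp : ∀ x, ∃ Q, IsCompact Q ∧ ∀ f ∈ s, f x ∈ Q) : IsCompact (closure s) := by
  refine ArzelaAscoli.isCompact_closure_of_isClosedEmbedding
    (F := fun (f : C(X, α)) (x : X) ↦ f x) (𝔖 := {K | IsCompact K}) (fun K hK ↦ hK)
    ⟨ContinuousMap.isUniformEmbedding_toUniformOnFunIsCompact.isEmbedding, ?_⟩
    (fun K _ ↦ hs.equicontinuousOn K) (fun K _ x _ ↦ hp x)
  change IsClosed (Set.range (ContinuousMap.toUniformOnFunIsCompact (α := X) (β := α)))
  rw [ContinuousMap.range_toUniformOnFunIsCompact]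
  exact UniformOnFun.isClosed_setOfPred_continuous CompactlyCoherentSpace.isCoherentWith

/-- The paths started at `z` whose modulus of continuity at time horizon `L n` and step `δ n` is
at most `1 / L n`, for all `n`. -/
def modulusSet (z : ℂ) (L δ : ℕ → ℝ) : Set PathSp :=
  {X | X 0 = z} ∩ ⋂ n, {X | ∀ s t : ℝ≥0, (s : ℝ) ≤ L n → (t : ℝ) ≤ L n →
    |(s : ℝ) - (t : ℝ)| ≤ δ n → dist (X s) (X t) ≤ 1 / L n}

lemma isClosed_setOf_modulus_le (L δ : ℝ) :
    IsClosed {X : PathSp | ∀ s t : ℝ≥0, (s : ℝ) ≤ L → (t : ℝ) ≤ L →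
      |(s : ℝ) - (t : ℝ)| ≤ δ → dist (X s) (X t) ≤ 1 / L} := by
  simp only [Set.ofPred_forall]
  refine isClosed_iInter fun s ↦ isClosed_iInter fun t ↦ isClosed_iInter fun _ ↦
    isClosed_iInter fun _ ↦ isClosed_iInter fun _ ↦ ?_
  exact isClosed_le (by fun_prop) continuous_const

lemma isClosed_setOf_start (z : ℂ) : IsClosed {X : PathSp | X 0 = z} :=
  isClosed_eq (by fun_prop) continuous_const

lemma dist_start_le {X : PathSp} {L δ : ℝ} (hδ : 0 < δ)
    (hX : ∀ s t : ℝ≥0, (s : ℝ) ≤ L → (t : ℝ) ≤ L →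
      |(s : ℝ) - (t : ℝ)| ≤ δ → dist (X s) (X t) ≤ 1 / L) (k : ℕ) :
    ∀ s : ℝ≥0, (s : ℝ) ≤ L → (s : ℝ) ≤ k * δ → dist (X s) (X 0) ≤ k * (1 / L) := by
  induction k with
  | zero =>
    intro s _ hs
    have : s = 0 := by
      apply le_antisymm _ zero_le
      exact_mod_cast (by simpa using hs : (s : ℝ) ≤ 0)
    simp [this]
  | succ k ih =>
    intro s hsL hs
    push_cast at hs ⊢
    have hL : 0 ≤ L := s.2.trans hsL
    have hmax : ((s - δ.toNNReal : ℝ≥0) : ℝ) = max ((s : ℝ) - δ) 0 := by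
      rw [NNReal.coe_sub_def, Real.coe_toNNReal _ hδ.le]
    have h0 : (0 : ℝ) ≤ s := s.2
    have h1 : ((s - δ.toNNReal : ℝ≥0) : ℝ) ≤ L := by
      rw [hmax]; exact max_le (by linarith) hL
    have h2 : ((s - δ.toNNReal : ℝ≥0) : ℝ) ≤ k * δ := by
      rw [hmax]; exact max_le (by linarith) (by positivity)
    have h3 : |(s : ℝ) - ((s - δ.toNNReal : ℝ≥0) : ℝ)| ≤ δ := by
      rw [hmax, abs_le]
      constructor
      · have : max ((s : ℝ) - δ) 0 ≤ s + δ := max_le (by linarith) (by linarith)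
        linarith
      · have := le_max_left ((s : ℝ) - δ) 0
        linarith
    have := dist_triangle (X s) (X (s - δ.toNNReal)) (X 0)
    have := hX s _ hsL h1 h3
    have := ih _ h1 h2
    linarith

lemma isCompact_modulusSet (z : ℂ) {L δ : ℕ → ℝ} (hL : ∀ n : ℕ, (n : ℝ) + 1 ≤ L n)
    (hδ : ∀ n, 0 < δ n) : IsCompact (modulusSet z L δ) := by
  have hcl : IsClosed (modulusSet z L δ) :=
    (isClosed_setOf_start z).inter (isClosed_iInter fun n ↦ isClosed_setOf_modulus_le _ _)
  rw [← hcl.closure_eq]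
  refine isCompact_closure_of_equicontinuous ?_ ?_
  · intro t
    rw [Metric.equicontinuousAt_iff]
    intro ε hε
    obtain ⟨n, hn⟩ := exists_nat_gt (max ((t : ℝ)) (1 / ε))
    have hnt := (le_max_left _ _).trans_lt hn
    have hnε := (le_max_right _ _).trans_lt hn
    refine ⟨min 1 (δ n), lt_min one_pos (hδ n), fun s hs X ↦ ?_⟩
    rw [NNReal.dist_eq] at hs
    have hs1 := hs.trans_le (min_le_left _ _)
    have hs2 := hs.trans_le (min_le_right _ _)
    have hX := Set.mem_iInter.1 X.2.2 n t s (by linarith [hL n])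
      (by linarith [hL n, (abs_lt.1 hs1).2]) (by rw [abs_sub_comm]; exact hs2.le)
    refine hX.trans_lt ?_
    have hLn : 1 / ε < L n := by linarith [hL n]
    exact (one_div_lt hε ((one_div_pos.2 hε).trans hLn)).1 hLn
  · intro t
    obtain ⟨n, hn⟩ := exists_nat_gt (t : ℝ)
    obtain ⟨k, hk⟩ := exists_nat_gt ((t : ℝ) / δ n)
    refine ⟨Metric.closedBall z (k * (1 / L n)), isCompact_closedBall _ _, fun X hX ↦ ?_⟩
    have h0 : X 0 = z := hX.1
    rw [Metric.mem_closedBall, ← h0]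
    exact dist_start_le (hδ n) (Set.mem_iInter.1 hX.2 n) k t (by linarith [hL n])
      ((div_lt_iff₀ (hδ n)).1 hk).le

lemma isTightMeasureSet_of_modulus (z : ℂ) {S : Set (ProbabilityMeasure PathSp)}
    (hstart : ∀ μ ∈ S, (μ : Measure PathSp) {X : PathSp | X 0 = z} = 1)
    (hmod : ∀ L : ℝ, 0 < L → ∃ δ : ℝ, 0 < δ ∧ ∀ μ ∈ S,
      ENNReal.ofReal (1 - 1 / L) ≤
        (μ : Measure PathSp)
          {X : PathSp | ∀ s t : ℝ≥0, (s : ℝ) ≤ L → (t : ℝ) ≤ L →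
            |(s : ℝ) - (t : ℝ)| ≤ δ → dist (X s) (X t) ≤ 1 / L}) :
    IsTightMeasureSet {((μ : ProbabilityMeasure PathSp) : Measure PathSp) | μ ∈ S} := by
  have : BorelSpace PathSp := ⟨rfl⟩
  rw [isTightMeasureSet_iff_exists_isCompact_measure_compl_le]
  intro ε hε
  obtain ⟨u, hu, hsum⟩ := ENNReal.exists_pos_sum_of_countable hε.ne' ℕ
  let L : ℕ → ℝ := fun n ↦ max ((n : ℝ) + 1) (1 / u n)
  have hL : ∀ n : ℕ, (n : ℝ) + 1 ≤ L n := fun n ↦ le_max_left _ _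
  have hLpos : ∀ n, 0 < L n := fun n ↦ lt_of_lt_of_le (by positivity) (hL n)
  choose δ hδ hδS using fun n ↦ hmod (L n) (hLpos n)
  refine ⟨modulusSet z L δ, isCompact_modulusSet z hL hδ, ?_⟩
  rintro _ ⟨μ, hμ, rfl⟩
  rw [modulusSet, Set.compl_inter, Set.compl_iInter]
  have hz : (μ : Measure PathSp) {X : PathSp | X 0 = z}ᶜ = 0 := by
    rw [prob_compl_eq_one_sub (isClosed_setOf_start z).measurableSet, hstart μ hμ, tsub_self]
  refine (measure_union_le _ _).trans ?_
  rw [hz, zero_add]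
  refine (measure_iUnion_le _).trans (le_trans (ENNReal.tsum_le_tsum fun n ↦ ?_) hsum.le)
  rw [prob_compl_eq_one_sub (isClosed_setOf_modulus_le _ _).measurableSet]
  refine (tsub_le_tsub_left (hδS n μ hμ) 1).trans ?_
  rw [tsub_le_iff_right]
  have hun : (0 : ℝ) < u n := hu n
  have hLu : 1 / L n ≤ u n := by
    rw [one_div_le (hLpos n) hun]
    exact le_max_right _ _
  have hL1 : 1 / L n ≤ 1 := by
    rw [div_le_one (hLpos n)]
    linarith [hL n, n.cast_nonneg (α := ℝ)]
  calc (1 : ℝ≥0∞) = ENNReal.ofReal (1 / L n + (1 - 1 / L n)) := by simp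
    _ = ENNReal.ofReal (1 / L n) + ENNReal.ofReal (1 - 1 / L n) :=
      ENNReal.ofReal_add (one_div_pos.2 (hLpos n)).le (by linarith)
    _ ≤ u n + ENNReal.ofReal (1 - 1 / L n) := by
      gcongr
      exact ENNReal.ofReal_le_of_le_toReal hLu

lemma sInf_eq_levyProkhorovDist {E : Type*} [MeasurableSpace E] [PseudoMetricSpace E]
    (μ ν : Measure E) [IsProbabilityMeasure μ] [IsProbabilityMeasure ν] :
    sInf {ε : ℝ | 0 < ε ∧ ∀ A : Set E, MeasurableSet A →
      (μ A ≤ ν (Metric.thickening ε A) + ENNReal.ofReal ε ∧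
        ν A ≤ μ (Metric.thickening ε A) + ENNReal.ofReal ε)} = levyProkhorovDist μ ν := by
  apply le_antisymm
  · refine le_of_forall_gt fun c hc ↦ ?_
    obtain ⟨b, hb, hbc⟩ := exists_between hc
    have hb0 : 0 < b := ENNReal.toReal_nonneg.trans_lt hb
    have hlt : levyProkhorovEDist μ ν < ENNReal.ofReal b :=
      (ENNReal.lt_ofReal_iff_toReal_lt (levyProkhorovEDist_ne_top μ ν)).2 hb
    refine lt_of_le_of_lt (csInf_le ⟨0, fun ε hε ↦ hε.1.le⟩ ⟨hb0, fun A hA ↦ ⟨?_, ?_⟩⟩) hbc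
    · simpa [ENNReal.toReal_ofReal hb0.le] using left_measure_le_of_levyProkhorovEDist_lt hlt hA
    · simpa [ENNReal.toReal_ofReal hb0.le] using right_measure_le_of_levyProkhorovEDist_lt hlt hA
  · refine le_csInf ⟨1, one_pos, fun A _ ↦ ?_⟩ ?_
    · rw [ENNReal.ofReal_one]
      exact ⟨prob_le_one.trans le_add_self, prob_le_one.trans le_add_self⟩
    · rintro ε ⟨hε, h⟩
      refine ENNReal.toReal_le_of_le_ofReal hε.le (sInf_le fun A hA ↦ ?_)
      rw [ENNReal.toReal_ofReal hε.le]
      exact h A hA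

lemma borelSpace_of_compat (dM : MetricSpace PathSp)
    (hcompat : dM.toUniformSpace.toTopologicalSpace
      = (inferInstance : TopologicalSpace PathSp)) :
    @BorelSpace PathSp dM.toUniformSpace.toTopologicalSpace _ := by
  rw [hcompat]
  exact ⟨rfl⟩

/-- The Lévy–Prokhorov metric induced by a metric on path space which is compatible with the
compact-open topology. -/
abbrev lpMetric (dM : MetricSpace PathSp)
    (hcompat : dM.toUniformSpace.toTopologicalSpace
      = (inferInstance : TopologicalSpace PathSp)) :
    MetricSpace (LevyProkhorov (ProbabilityMeasure PathSp)) :=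
  letI := borelSpace_of_compat dM hcompat
  @LevyProkhorov.levyProkhorovDist_metricSpace_probabilityMeasure PathSp _
    dM.toPseudoMetricSpace.toPseudoEMetricSpace _ _

section

variable (dM : MetricSpace PathSp) (hcompat : dM.toUniformSpace.toTopologicalSpace
  = (inferInstance : TopologicalSpace PathSp))

lemma prokDist_eq_dist (μ ν : ProbabilityMeasure PathSp) :
    letI := lpMetric dM hcompat
    prokDist dM μ ν = dist (LevyProkhorov.ofMeasure μ) (LevyProkhorov.ofMeasure ν) := by
  refine Eq.trans ?_ (@sInf_eq_levyProkhorovDist PathSp _ dM.toPseudoMetricSpace μ ν _ _)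
  have hthick : ∀ ε A, thick dM ε A = @Metric.thickening PathSp
      dM.toPseudoMetricSpace.toPseudoEMetricSpace ε A := by
    intro ε A
    ext g
    let := dM.toPseudoMetricSpace
    rw [Metric.mem_thickening_iff]
    simp only [dist_comm g]
    rfl
  simp only [prokDist, hthick]

lemma prokTop_eq_induced :
    letI := lpMetric dM hcompat
    prokTop dM = TopologicalSpace.induced LevyProkhorov.ofMeasure inferInstance := by
  let := lpMetric dM hcompat
  apply le_antisymm
  · rw [← continuous_iff_le_induced]
    let := prokTop dM
    rw [continuous_iff_continuousAt]
    intro μ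
    rw [ContinuousAt, Metric.tendsto_nhds]
    intro ε hε
    refine Filter.mem_of_superset (IsOpen.mem_nhds
      (TopologicalSpace.isOpen_generateFrom_of_mem ⟨μ, ε, hε, rfl⟩) ?_) ?_
    · change prokDist dM μ μ < ε
      rwa [prokDist_eq_dist dM hcompat, dist_self]
    · intro ν hν
      change prokDist dM μ ν < ε at hν
      rw [prokDist_eq_dist dM hcompat, dist_comm] at hν
      exact hν
  · refine le_generateFrom ?_
    rintro _ ⟨μ, ε, -, rfl⟩
    refine ⟨{ν | dist (LevyProkhorov.ofMeasure μ) ν < ε},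
      isOpen_lt (by fun_prop) continuous_const, ?_⟩
    ext ν
    simp only [prokDist_eq_dist dM hcompat]
    rfl

/-- The identification of `𝒞` with the space of continuous maps into the probability measures
with the Lévy–Prokhorov metric. -/
def cspEquiv :
    letI := lpMetric dM hcompat
    CSp dM ≃ C(ℂ, LevyProkhorov (ProbabilityMeasure PathSp)) :=
  letI := lpMetric dM hcompat
  { toFun := fun P ↦ ⟨fun z ↦ .ofMeasure (P.1 z), by
      exact continuous_induced_rng.1
        (continuous_iff_le_induced.2 <| (continuous_iff_le_induced.1 P.2).trans_eq <|
          congrArg _ (prokTop_eq_induced dM hcompat))⟩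
    invFun := fun Q ↦ ⟨fun z ↦ (Q z).toMeasure, by
      rw [prokTop_eq_induced dM hcompat, continuous_induced_rng]
      exact Q.continuous⟩
    left_inv := fun _ ↦ rfl
    right_inv := fun _ ↦ rfl }

lemma isInducing_cspEquiv :
    letI := lpMetric dM hcompat
    letI := CTop dM
    IsInducing (cspEquiv dM hcompat) := by
  let := lpMetric dM hcompat
  let := CTop dM
  refine ⟨le_antisymm ?_ ?_⟩
  · rw [← continuous_iff_le_induced, continuous_iff_continuousAt]
    intro P
    rw [ContinuousAt, ContinuousMap.tendsto_iff_forall_isCompact_tendstoUniformlyOn]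
    intro K hK
    rw [Metric.tendstoUniformlyOn_iff]
    intro ε hε
    refine Filter.mem_of_superset (IsOpen.mem_nhds
      (TopologicalSpace.isOpen_generateFrom_of_mem ⟨P, K, ε, hK, hε, rfl⟩) ?_) ?_
    · intro z _
      rwa [prokDist_eq_dist dM hcompat, dist_self]
    · intro Q hQ z hz
      have := hQ z hz
      rw [prokDist_eq_dist dM hcompat] at this
      exact this
  · refine le_generateFrom ?_
    rintro _ ⟨P, K, ε, hK, -, rfl⟩
    let d : C(ℂ, LevyProkhorov (ProbabilityMeasure PathSp)) → C(ℂ, ℝ) := fun Q ↦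
      ⟨fun z ↦ dist (cspEquiv dM hcompat P z) (Q z), by fun_prop⟩
    have hd : Continuous d := by
      refine ContinuousMap.continuous_of_continuous_uncurry _ ?_
      change Continuous fun x : C(ℂ, LevyProkhorov (ProbabilityMeasure PathSp)) × ℂ ↦
        dist (cspEquiv dM hcompat P x.2) (x.1 x.2)
      fun_prop
    refine ⟨_, (ContinuousMap.isOpen_setOfPred_mapsTo hK (isOpen_Iio (a := ε))).preimage hd, ?_⟩
    ext Q
    simp only [prokDist_eq_dist dM hcompat]
    rfl

lemma exists_isCompact_of_isTightMeasureSet [TopologicalSpace.SeparableSpace PathSp]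
    {S : Set (ProbabilityMeasure PathSp)}
    (hS : IsTightMeasureSet {((μ : ProbabilityMeasure PathSp) : Measure PathSp) | μ ∈ S}) :
    letI := lpMetric dM hcompat
    ∃ Q : Set (LevyProkhorov (ProbabilityMeasure PathSp)),
      IsCompact Q ∧ ∀ μ ∈ S, LevyProkhorov.ofMeasure μ ∈ Q := by
  have hsep : @TopologicalSpace.SeparableSpace PathSp dM.toUniformSpace.toTopologicalSpace := by
    rw [hcompat]; assumption
  have hB := borelSpace_of_compat dM hcompat
  have hS' : @IsTightMeasureSet PathSp _ dM.toUniformSpace.toTopologicalSpace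
      {((μ : ProbabilityMeasure PathSp) : Measure PathSp) | μ ∈ S} := by
    rw [hcompat]; exact hS
  have key : ∀ {E : Type} [MeasurableSpace E] [MetricSpace E] [BorelSpace E]
      [TopologicalSpace.SeparableSpace E] {S : Set (ProbabilityMeasure E)},
      IsTightMeasureSet {((μ : ProbabilityMeasure E) : Measure E) | μ ∈ S} →
      ∃ Q : Set (LevyProkhorov (ProbabilityMeasure E)),
        IsCompact Q ∧ ∀ μ ∈ S, LevyProkhorov.ofMeasure μ ∈ Q := fun hS ↦
    ⟨_, (isCompact_closure_of_isTightMeasureSet hS).image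
      LevyProkhorov.probabilityMeasureHomeomorph.continuous,
      fun μ hμ ↦ ⟨μ, subset_closure hμ, rfl⟩⟩
  exact @key PathSp _ dM hB hsep S hS'

end

theorem stmt7
    -- `d_Unif` : a complete separable metric on `C([0,∞), ℂ)` inducing the topology of
    -- uniform convergence on compact time intervals
    (dM : MetricSpace PathSp)
    (hcompat : dM.toUniformSpace.toTopologicalSpace
      = (inferInstance : TopologicalSpace PathSp))
    (hcomplete : @CompleteSpace PathSp dM.toUniformSpace)
    (hsep : TopologicalSpace.SeparableSpace PathSp)
    (𝒦 : Set (CSp dM))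
    -- each `P_z` is supported on paths started at `z`
    (hstart : ∀ P ∈ 𝒦, ∀ z : ℂ, (P.1 z : Measure PathSp) {X : PathSp | X 0 = z} = 1)
    -- (1) equicontinuity of laws
    (h1 : ∀ L : ℝ, 1 < L → ∃ δ : ℝ, 0 < δ ∧ ∀ P ∈ 𝒦, ∀ z w : ℂ,
      z ∈ Metric.ball (0 : ℂ) L → w ∈ Metric.ball (0 : ℂ) L → dist z w ≤ δ →
        prokDist dM (P.1 z) (P.1 w) ≤ 1 / L)
    -- (2) equicontinuity of paths
    (h2 : ∀ L : ℝ, 0 < L → ∀ z : ℂ, ∃ δ : ℝ, 0 < δ ∧ ∀ P ∈ 𝒦,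
      ENNReal.ofReal (1 - 1 / L) ≤
        (P.1 z : Measure PathSp)
          {X : PathSp | ∀ s t : ℝ≥0, (s : ℝ) ≤ L → (t : ℝ) ≤ L →
            |(s : ℝ) - (t : ℝ)| ≤ δ → dist (X s) (X t) ≤ 1 / L}) :
    @IsCompact (CSp dM) (CTop dM) (@closure (CSp dM) (CTop dM) 𝒦) := by
  let := lpMetric dM hcompat
  let := CTop dM
  have hind := isInducing_cspEquiv dM hcompat
  let e := (cspEquiv dM hcompat).toHomeomorphOfIsInducing hind
  suffices h : IsCompact (closure (e '' 𝒦)) by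
    rw [← e.image_closure] at h
    exact e.isCompact_image.1 h
  refine isCompact_closure_of_equicontinuous ?_ ?_
  · intro z
    rw [Metric.equicontinuousAt_iff]
    intro ε hε
    obtain ⟨L, hL⟩ := exists_gt (max (‖z‖ + 1) (1 / ε))
    have hLz := (le_max_left _ _).trans_lt hL
    have hLε := (le_max_right _ _).trans_lt hL
    have hL1 : 1 < L := by linarith [norm_nonneg z]
    obtain ⟨δ, hδ, h⟩ := h1 L hL1
    refine ⟨min 1 δ, lt_min one_pos hδ, ?_⟩
    rintro w hw ⟨_, P, hP, rfl⟩
    have hw1 := hw.trans_le (min_le_left _ _)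
    have hw2 := hw.trans_le (min_le_right _ _)
    have hwL : ‖w‖ < L := by
      have : ‖w‖ ≤ ‖w - z‖ + ‖z‖ := by simpa using norm_add_le (w - z) z
      rw [dist_eq_norm] at hw1
      linarith
    have hd := h P hP z w (by rw [mem_ball_zero_iff]; linarith) (by rwa [mem_ball_zero_iff])
      (by rw [dist_comm]; exact hw2.le)
    rw [prokDist_eq_dist dM hcompat] at hd
    exact hd.trans_lt ((one_div_lt hε (one_pos.trans hL1)).1 hLε)
  · intro z
    obtain ⟨Q, hQ, hmem⟩ := exists_isCompact_of_isTightMeasureSet dM hcompat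
      (isTightMeasureSet_of_modulus z (S := (fun P : CSp dM ↦ P.1 z) '' 𝒦)
        (by rintro _ ⟨P, hP, rfl⟩; exact hstart P hP z)
        (fun L hL ↦ by
          obtain ⟨δ, hδ, h⟩ := h2 L hL z
          exact ⟨δ, hδ, by rintro _ ⟨P, hP, rfl⟩; exact h P hP⟩))
    refine ⟨Q, hQ, ?_⟩
    rintro _ ⟨P, hP, rfl⟩
    exact hmem _ ⟨P, hP, rfl⟩
end
end

section
/- Let 𝓑 be a standard linear Brownian motion, and for each integer n ≥ 1 let 𝒦_n be the number of indices k ∈ {1,…,n} such that the interval [k−1, k] contains a running minimum of 𝓑, i.e., such that there exists t ∈ [k−1, k] with 𝓑_t = inf_{0 ≤ s ≤ t} 𝓑_s. Then there exist universal constants c₁, c₂ > 0 such that ℙ[𝒦_n > m] ≤ c₁ e^{−c₂ m / n^{1/2}} for all integers n, m ≥ 1. -/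
open MeasureTheory ProbabilityTheory Filter
open scoped Classical ENNReal NNReal

noncomputable section

/-- `B` is a standard linear Brownian motion on `(Ω, μ)`: it starts at `0`, has continuous
sample paths, and for `0 ≤ s ≤ t` the increment `B_t − B_s` is independent of `(B_u)_{u ≤ s}`
and Gaussian with mean `0` and variance `t − s`. -/
structure IsLinearBM {Ω : Type*} [MeasurableSpace Ω] (μ : Measure Ω)
    (B : ℝ → Ω → ℝ) : Prop where
  meas : ∀ t : ℝ, Measurable (B t)
  start : ∀ᵐ ω ∂μ, B 0 ω = 0
  cont : ∀ᵐ ω ∂μ, Continuous fun t => B t ω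
  indep : ∀ s t : ℝ, 0 ≤ s → s ≤ t →
    Indep (MeasurableSpace.comap (fun ω => B t ω - B s ω) inferInstance)
      (⨆ u ∈ Set.Icc (0 : ℝ) s, MeasurableSpace.comap (B u) inferInstance) μ
  incr : ∀ s t : ℝ, 0 ≤ s → s ≤ t →
    μ.map (fun ω => B t ω - B s ω) = gaussianReal 0 (Real.toNNReal (t - s))

/-- The number of `k ∈ {1,…,n}` such that the interval `[k−1,k]` contains a running minimum
of `t ↦ B t ω`, i.e. a time `t` with `B t ω = inf_{0 ≤ s ≤ t} B s ω`. -/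
def runMinCount {Ω : Type*} (B : ℝ → Ω → ℝ) (n : ℕ) (ω : Ω) : ℕ :=
  ((Finset.Icc 1 n).filter fun k =>
    ∃ t ∈ Set.Icc ((k : ℝ) - 1) (k : ℝ),
      B t ω = sInf ((fun s => B s ω) '' Set.Icc (0 : ℝ) t)).card

/-- A convex, increasing, `1`-Lipschitz function on `[0, ∞)` with vanishing slope at `0`. -/
def hgt (y : ℝ) : ℝ := y + Real.exp (-y)

/-- A lower bound for the convexity defect of `hgt`. -/
def gain : ℝ → ℝ := (Set.Ici (1 : ℝ)).indicator fun _ => Real.exp (-1)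

/-- A bound for the second-order Taylor remainder of `exp`. -/
def rem (x : ℝ) : ℝ := 2 * (Real.exp (2 * x) + Real.exp (-2 * x))

/-- The expected gain of `hgt` over a standard Gaussian step. -/
def gainConst : ℝ := ∫ x, gain x ∂gaussianReal 0 1

/-- The expected remainder over a standard Gaussian step. -/
def remConst : ℝ := ∫ x, rem x ∂gaussianReal 0 1

/-- The exponential moment used to bound the running minimum over a unit interval. -/
def expConst : ℝ := 2 * Real.exp 2 * ∫ x, Real.exp (-2 * x) ∂gaussianReal 0 1

lemma exp_le_taylor (u : ℝ) : Real.exp u ≤ 1 + u + u ^ 2 * Real.exp |u| := by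
  have h := Complex.norm_exp_sub_sum_le_norm_mul_exp (u : ℂ) 2
  have h2 : Complex.exp u - ∑ m ∈ Finset.range 2, (u : ℂ) ^ m / m.factorial
      = ((Real.exp u - (1 + u) : ℝ) : ℂ) := by
    simp [Finset.sum_range_succ]
  rw [h2, Complex.norm_real, Complex.norm_real, Real.norm_eq_abs, Real.norm_eq_abs, sq_abs] at h
  linarith [le_abs_self (Real.exp u - (1 + u))]

lemma sq_mul_exp_le_rem (x : ℝ) : x ^ 2 * Real.exp |x| ≤ rem x := by
  have h1 : x ^ 2 ≤ 2 * Real.exp |x| := by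
    have := Real.quadratic_le_exp_of_nonneg (abs_nonneg x)
    rw [sq_abs] at this
    nlinarith [abs_nonneg x]
  have h2 : x ^ 2 * Real.exp |x| ≤ 2 * Real.exp (2 * |x|) := by
    rw [two_mul |x|, Real.exp_add]
    nlinarith [Real.exp_pos |x|]
  have := Real.exp_pos (2 * x)
  have := Real.exp_pos (-2 * x)
  unfold rem
  rcases abs_cases x with ⟨h, -⟩ | ⟨h, -⟩
  · rw [h] at h2 ⊢; linarith
  · rw [h] at h2 ⊢; rw [show 2 * -x = -2 * x by ring] at h2; linarith

lemma abs_hgt_sub_le {u v : ℝ} (hu : 0 ≤ u) (hv : 0 ≤ v) : |hgt u - hgt v| ≤ |u - v| := by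
  wlog h : v ≤ u generalizing u v
  · rw [abs_sub_comm, abs_sub_comm u]
    exact this hv hu (le_of_not_ge h)
  have h1 : Real.exp (-u) ≤ Real.exp (-v) := Real.exp_le_exp.2 (by linarith)
  have h2 : Real.exp (-v) ≤ 1 := Real.exp_le_one_iff.2 (by linarith)
  have h3 : Real.exp (-u) = Real.exp (-v) * Real.exp (-(u - v)) := by
    rw [← Real.exp_add]; ring_nf
  have h4 := Real.add_one_le_exp (-(u - v))
  have h5 := Real.exp_pos (-v)
  rw [abs_of_nonneg (a := u - v) (by linarith), abs_le]
  unfold hgt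
  constructor <;> nlinarith

lemma gain_le_hgt_sub (y x : ℝ) (hy : 0 ≤ y) :
    (1 - Real.exp (-y)) * x + Real.exp (-y) * gain x ≤ hgt (max (y + x) 0) - hgt y := by
  have hp := Real.exp_pos (-y)
  have h1 : Real.exp (-y) ≤ 1 := Real.exp_le_one_iff.2 (by linarith)
  unfold hgt gain
  rcases le_total 0 (y + x) with h | h
  · rw [max_eq_left h, neg_add, Real.exp_add]
    have h4 := Real.add_one_le_exp (-x)
    by_cases hx : (1 : ℝ) ≤ x
    · rw [Set.indicator_of_mem (by exact hx)]
      have h5 := Real.add_one_le_exp (-x + 1)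
      have h6 : Real.exp (-1) ≤ 1 := Real.exp_le_one_iff.2 (by norm_num)
      have h7 : Real.exp (-1) ≤ Real.exp (-x) - 1 + x := by
        have h8 : Real.exp (-x) = Real.exp (-1) * Real.exp (-x + 1) := by
          rw [← Real.exp_add]; ring_nf
        have h9 := Real.exp_pos (-1)
        nlinarith
      nlinarith
    · rw [Set.indicator_of_notMem (by exact hx)]
      nlinarith
  · rw [max_eq_right h, Set.indicator_of_notMem (by simp; linarith)]
    have h4 := Real.add_one_le_exp y
    have h5 : Real.exp (-y) * Real.exp y = 1 := by rw [← Real.exp_add]; simp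
    simp only [neg_zero, Real.exp_zero]
    nlinarith

lemma exp_neg_hgt_step {b y : ℝ} (x : ℝ) (hb : 0 ≤ b) (hb1 : b ≤ 1) (hy : 0 ≤ y) :
    Real.exp (-(b * hgt (max (y + x) 0))) ≤ Real.exp (-(b * hgt y)) *
      (1 - b * ((1 - Real.exp (-y)) * x + Real.exp (-y) * gain x) + b ^ 2 * rem x) := by
  set d := hgt (max (y + x) 0) - hgt y with hd
  have h1 : |d| ≤ |x| := by
    refine (abs_hgt_sub_le (le_max_right _ _) hy).trans ?_
    rcases le_total 0 (y + x) with h | h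
    · rw [max_eq_left h]; simp
    · rw [max_eq_right h, abs_of_nonpos (by linarith), abs_of_nonpos (by linarith : x ≤ 0)]
      linarith
  have h2 := gain_le_hgt_sub y x hy
  have h3 : Real.exp (-(b * hgt (max (y + x) 0)))
      = Real.exp (-(b * hgt y)) * Real.exp (-(b * d)) := by
    rw [← Real.exp_add, hd]; ring_nf
  rw [h3]
  refine mul_le_mul_of_nonneg_left ?_ (Real.exp_pos _).le
  refine (exp_le_taylor _).trans ?_
  have h4 : |-(b * d)| ≤ |x| := by
    rw [abs_neg, abs_mul, abs_of_nonneg hb]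
    nlinarith [abs_nonneg d]
  have h5 : d ^ 2 * Real.exp |-(b * d)| ≤ rem x := by
    refine le_trans ?_ (sq_mul_exp_le_rem x)
    exact mul_le_mul (sq_le_sq.2 h1) (Real.exp_le_exp.2 h4) (Real.exp_pos _).le (sq_nonneg _)
  have h6 := mul_le_mul_of_nonneg_left h2 hb
  have h7 := mul_le_mul_of_nonneg_left h5 (sq_nonneg b)
  nlinarith

lemma integrable_rem : Integrable rem (gaussianReal 0 1) :=
  ((integrable_exp_mul_gaussianReal 2).add (integrable_exp_mul_gaussianReal (-2))).const_mul 2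

lemma measurable_gain : Measurable gain :=
  measurable_const.indicator measurableSet_Ici

lemma integrable_gain : Integrable gain (gaussianReal 0 1) :=
  (integrable_const _).indicator measurableSet_Ici

lemma integrable_id_gaussian : Integrable (fun x : ℝ => x) (gaussianReal 0 1) :=
  (memLp_id_gaussianReal 1).integrable le_rfl

lemma gainConst_pos : 0 < gainConst := by
  unfold gainConst gain
  rw [integral_indicator measurableSet_Ici, setIntegral_const, smul_eq_mul]
  refine mul_pos ?_ (Real.exp_pos _)
  refine lt_of_le_of_ne measureReal_nonneg fun h => ?_
  have h0 : gaussianReal 0 1 (Set.Ici 1) = 0 := by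
    rw [← measureReal_eq_zero_iff]; exact h.symm
  have := gaussianReal_absolutelyContinuous' 0 one_ne_zero h0
  simp at this

lemma remConst_nonneg : 0 ≤ remConst :=
  integral_nonneg fun x => by unfold rem; positivity

lemma expConst_pos : 0 < expConst := by
  refine mul_pos (by positivity) ?_
  exact integral_exp_pos (integrable_exp_mul_gaussianReal (-2))

lemma half_le_gaussianReal_Iic (v : ℝ≥0) : 1 / 2 ≤ (gaussianReal 0 v).real (Set.Iic 0) := by
  have h : (gaussianReal 0 v).real (Set.Ici 0) = (gaussianReal 0 v).real (Set.Iic 0) := by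
    conv_lhs => rw [← neg_zero, ← gaussianReal_map_neg]
    rw [map_measureReal_apply measurable_neg measurableSet_Ici]
    simp
  have h2 := measureReal_union_le (μ := gaussianReal 0 v) (Set.Iic 0) (Set.Ici 0)
  rw [Set.Iic_union_Ici, probReal_univ, h] at h2
  linarith

/-- The `σ`-algebra generated by the path up to time `t`. -/
@[reducible]
def pastSigma {Ω : Type*} (B : ℝ → Ω → ℝ) (t : ℝ) : MeasurableSpace Ω :=
  ⨆ u ∈ Set.Icc (0 : ℝ) t, MeasurableSpace.comap (B u) inferInstance

lemma measurable_pastSigma {Ω : Type*} {B : ℝ → Ω → ℝ} {u t : ℝ} (hu : 0 ≤ u) (hut : u ≤ t) :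
    Measurable[pastSigma B t] (B u) := by
  rw [measurable_iff_comap_le]
  exact le_iSup₂_of_le u ⟨hu, hut⟩ le_rfl

lemma pastSigma_mono {Ω : Type*} {B : ℝ → Ω → ℝ} {s t : ℝ} (h : s ≤ t) : pastSigma B s ≤ pastSigma B t :=
  biSup_mono fun _ hu => ⟨hu.1, hu.2.trans h⟩

namespace IsLinearBM

variable {Ω : Type*} [mΩ : MeasurableSpace Ω] {μ : Measure Ω} {B : ℝ → Ω → ℝ}

lemma pastSigma_le (hB : IsLinearBM μ B) (t : ℝ) : pastSigma B t ≤ mΩ :=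
  iSup₂_le fun u _ => (hB.meas u).comap_le

lemma measurable_incr (hB : IsLinearBM μ B) (s t : ℝ) : Measurable fun ω => B t ω - B s ω :=
  (hB.meas t).sub (hB.meas s)

lemma indepFun_incr (hB : IsLinearBM μ B) {s t : ℝ} (hs : 0 ≤ s) (hst : s ≤ t)
    {Z : Ω → ℝ} (hZ : Measurable[pastSigma B s] Z) {g : ℝ → ℝ} (hg : Measurable g) :
    IndepFun Z (fun ω => g (B t ω - B s ω)) μ := by
  rw [IndepFun_iff_Indep]
  refine indep_of_indep_of_le_right (indep_of_indep_of_le_left (hB.indep s t hs hst).symm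
    hZ.comap_le) ?_
  exact measurable_iff_comap_le.1 (hg.comp (comap_measurable _))

lemma integral_mul_incr (hB : IsLinearBM μ B) {s t : ℝ} (hs : 0 ≤ s) (hst : s ≤ t)
    {Z : Ω → ℝ} (hZ : Measurable[pastSigma B s] Z) {g : ℝ → ℝ} (hg : Measurable g) :
    ∫ ω, Z ω * g (B t ω - B s ω) ∂μ
      = (∫ ω, Z ω ∂μ) * ∫ x, g x ∂gaussianReal 0 (Real.toNNReal (t - s)) := by
  have hi := hB.measurable_incr s t
  rw [(hB.indepFun_incr hs hst hZ hg).integral_fun_mul_eq_mul_integral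
    (hZ.mono (hB.pastSigma_le s) le_rfl).aestronglyMeasurable
    (hg.comp hi).aestronglyMeasurable, ← hB.incr s t hs hst,
    integral_map hi.aemeasurable hg.aestronglyMeasurable]

lemma integrable_mul_incr (hB : IsLinearBM μ B) {s t : ℝ} (hs : 0 ≤ s) (hst : s ≤ t)
    {Z : Ω → ℝ} (hZ : Measurable[pastSigma B s] Z) (hZi : Integrable Z μ)
    {g : ℝ → ℝ} (hg : Measurable g)
    (hgi : Integrable g (gaussianReal 0 (Real.toNNReal (t - s)))) :
    Integrable (fun ω => Z ω * g (B t ω - B s ω)) μ := by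
  refine (hB.indepFun_incr hs hst hZ hg).integrable_mul hZi ?_
  rw [← hB.incr s t hs hst] at hgi
  exact (integrable_map_measure hg.aestronglyMeasurable
    (hB.measurable_incr s t).aemeasurable).1 hgi

/-- By symmetry, an event of the past is at most halved when the next increment is required to
be nonpositive. -/
lemma setIntegral_le_two_mul (hB : IsLinearBM μ B) {s t : ℝ} (hs : 0 ≤ s) (hst : s ≤ t)
    {W : Ω → ℝ} (hW : Measurable[pastSigma B s] W) (hW0 : ∀ ω, 0 ≤ W ω)
    {D : Set Ω} (hD : MeasurableSet[pastSigma B s] D) :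
    ∫ ω in D, W ω ∂μ ≤ 2 * ∫ ω in D ∩ {ω | B t ω - B s ω ≤ 0}, W ω ∂μ := by
  have hDm := hB.pastSigma_le s D hD
  have hm : MeasurableSet {ω | B t ω - B s ω ≤ 0} :=
    measurableSet_le (hB.measurable_incr s t) measurable_const
  have h := hB.integral_mul_incr hs hst (hW.indicator hD)
    (g := (Set.Iic (0 : ℝ)).indicator fun _ => 1) (measurable_const.indicator measurableSet_Iic)
  rw [integral_indicator measurableSet_Iic, setIntegral_const, smul_eq_mul, mul_one,
    integral_indicator hDm] at h
  have h2 : ∫ ω in D ∩ {ω | B t ω - B s ω ≤ 0}, W ω ∂μ = ∫ ω, D.indicator W ω *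
      (Set.Iic (0 : ℝ)).indicator (fun _ => (1 : ℝ)) (B t ω - B s ω) ∂μ := by
    rw [← integral_indicator (hDm.inter hm)]
    congr 1 with ω
    by_cases h1 : ω ∈ D <;> by_cases h2 : B t ω - B s ω ≤ 0 <;>
      simp [-tsub_le_iff_right, h1, h2]
  rw [h2, h]
  have := half_le_gaussianReal_Iic (Real.toNNReal (t - s))
  have h0 : 0 ≤ ∫ ω in D, W ω ∂μ := integral_nonneg hW0
  nlinarith

/-- A discrete reflection inequality, weighted by a nonnegative variable of the past. -/
lemma setIntegral_exists_lt_le (hB : IsLinearBM μ B) {s e : ℝ} (hs : 0 ≤ s) {τ : ℕ → ℝ}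
    (hτ : Monotone τ) (hsτ : ∀ i, s ≤ τ i) {W L : Ω → ℝ} (hW : Measurable[pastSigma B s] W)
    (hW0 : ∀ ω, 0 ≤ W ω) (hWi : Integrable W μ) (hL : Measurable[pastSigma B s] L)
    (M : ℕ) (hM : ∀ i < M, τ i ≤ e) :
    ∫ ω in {ω | ∃ i < M, B (τ i) ω < L ω}, W ω ∂μ
      ≤ 2 * ∫ ω in {ω | ∃ i < M, B (τ i) ω < L ω} ∩ {ω | B e ω < L ω}, W ω ∂μ := by
  have hlt : ∀ t, s ≤ t → ∀ u, s ≤ u → u ≤ t →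
      MeasurableSet[pastSigma B t] {ω | B u ω < L ω} := fun t ht u hu hut =>
    measurableSet_lt (measurable_pastSigma (hs.trans hu) hut)
      (hL.mono (pastSigma_mono ht) le_rfl)
  have hU : ∀ M : ℕ, ∀ t, s ≤ t → (∀ i < M, τ i ≤ t) →
      MeasurableSet[pastSigma B t] {ω | ∃ i < M, B (τ i) ω < L ω} := by
    intro M t hst ht
    have : {ω | ∃ i < M, B (τ i) ω < L ω} = ⋃ i : Fin M, {ω | B (τ i) ω < L ω} := by
      ext ω; simp [Fin.exists_iff]
    rw [this]
    exact MeasurableSet.iUnion fun i => hlt t hst _ (hsτ _) (ht _ i.2)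
  induction M with
  | zero => simp
  | succ M ih =>
    have ih := ih fun i hi => hM i (hi.trans M.lt_succ_self)
    set U : Set Ω := {ω | ∃ i < M, B (τ i) ω < L ω} with hUd
    set D : Set Ω := {ω | B (τ M) ω < L ω} \ U with hDd
    set E : Set Ω := {ω | B e ω < L ω} with hE
    have hsplit : {ω | ∃ i < M + 1, B (τ i) ω < L ω} = U ∪ D := by
      rw [hDd, Set.union_sdiff_self]
      ext ω
      simp only [Set.mem_ofPred_eq, Set.mem_union, hUd, Nat.lt_succ_iff_lt_or_eq]
      constructor
      · rintro ⟨i, hi | rfl, h⟩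
        exacts [Or.inl ⟨i, hi, h⟩, Or.inr h]
      · rintro (⟨i, hi, h⟩ | h)
        exacts [⟨i, Or.inl hi, h⟩, ⟨M, Or.inr rfl, h⟩]
    have hUM := hU M (τ M) (hsτ M) fun i hi => hτ hi.le
    have hDM : MeasurableSet[pastSigma B (τ M)] D :=
      (hlt _ (hsτ M) _ (hsτ M) le_rfl).diff hUM
    have hDm := hB.pastSigma_le _ _ hDM
    have hLm := hL.mono (hB.pastSigma_le s) le_rfl
    have hEm : MeasurableSet E := measurableSet_lt (hB.meas e) hLm
    have hdisj : Disjoint U D := Set.disjoint_sdiff_right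
    rw [hsplit, Set.union_inter_distrib_right,
      setIntegral_union hdisj hDm hWi.integrableOn hWi.integrableOn,
      setIntegral_union (hdisj.mono Set.inter_subset_left Set.inter_subset_left)
        (hDm.inter hEm) hWi.integrableOn hWi.integrableOn]
    have hD2 := hB.setIntegral_le_two_mul (hs.trans (hsτ M)) (hM M M.lt_succ_self)
      (hW.mono (pastSigma_mono (hsτ M)) le_rfl) hW0 hDM
    have hD3 : ∫ ω in D ∩ {ω | B e ω - B (τ M) ω ≤ 0}, W ω ∂μ ≤ ∫ ω in D ∩ E, W ω ∂μ := by
      refine setIntegral_mono_set hWi.integrableOn (ae_of_all _ hW0) ?_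
      refine LE.le.eventuallyLE ?_
      rintro ω ⟨h1, h2⟩
      refine ⟨h1, ?_⟩
      have h3 : B (τ M) ω < L ω := h1.1
      have h4 : B e ω - B (τ M) ω ≤ 0 := h2
      change B e ω < L ω
      linarith
    linarith

/-- The event that the path comes within distance `1` of a level lying `Y` below its present value
during the next unit of time, tested along a finite grid, has conditional probability of order
`exp (-2 * Y)`. -/
lemma setIntegral_dip_le (hB : IsLinearBM μ B) {s : ℝ} (hs : 0 ≤ s) {τ : ℕ → ℝ}
    (hτ : Monotone τ) (hsτ : ∀ i, s ≤ τ i) {W Y : Ω → ℝ} (hW : Measurable[pastSigma B s] W)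
    (hW0 : ∀ ω, 0 ≤ W ω) (hWi : Integrable W μ) (hY : Measurable[pastSigma B s] Y)
    (hY0 : ∀ ω, 0 ≤ Y ω) (M : ℕ) (hM : ∀ i < M, τ i ≤ s + 1) :
    ∫ ω in {ω | ∃ i < M, B (τ i) ω < B s ω - Y ω + 1}, W ω ∂μ
      ≤ expConst * ∫ ω, W ω * Real.exp (-2 * Y ω) ∂μ := by
  have hL : Measurable[pastSigma B s] fun ω => B s ω - Y ω + 1 :=
    ((measurable_pastSigma hs le_rfl).sub hY).add_const 1
  refine (hB.setIntegral_exists_lt_le hs hτ hsτ hW hW0 hWi hL M hM).trans ?_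
  have hZ : Measurable[pastSigma B s] fun ω => W ω * Real.exp (-2 * Y ω) :=
    hW.mul (Real.measurable_exp.comp (hY.const_mul (-2)))
  have hZi : Integrable (fun ω => W ω * Real.exp (-2 * Y ω)) μ := by
    refine hWi.mono (hZ.mono (hB.pastSigma_le s) le_rfl).aestronglyMeasurable
      (ae_of_all _ fun ω => ?_)
    rw [norm_mul, Real.norm_of_nonneg (Real.exp_pos _).le]
    refine mul_le_of_le_one_right (norm_nonneg _) (Real.exp_le_one_iff.2 ?_)
    linarith [hY0 ω]
  have hg : Measurable fun x : ℝ => Real.exp (-2 * x) := by fun_prop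
  have h1 : Real.toNNReal (s + 1 - s) = 1 := by simp
  have hint := hB.integral_mul_incr hs (le_add_of_nonneg_right zero_le_one : s ≤ s + 1) hZ hg
  have hinti := hB.integrable_mul_incr hs (le_add_of_nonneg_right zero_le_one : s ≤ s + 1) hZ hZi
    hg (h1 ▸ integrable_exp_mul_gaussianReal (-2))
  rw [h1] at hint
  have key : ∫ ω in {ω | ∃ i < M, B (τ i) ω < B s ω - Y ω + 1} ∩
      {ω | B (s + 1) ω < B s ω - Y ω + 1}, W ω ∂μ
      ≤ Real.exp 2 * ∫ ω, W ω * Real.exp (-2 * Y ω) *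
        Real.exp (-2 * (B (s + 1) ω - B s ω)) ∂μ := by
    have hE : MeasurableSet {ω | B (s + 1) ω < B s ω - Y ω + 1} :=
      measurableSet_lt (hB.meas _) (hL.mono (hB.pastSigma_le s) le_rfl)
    refine (setIntegral_mono_set hWi.integrableOn (ae_of_all _ hW0)
      (LE.le.eventuallyLE Set.inter_subset_right)).trans ?_
    rw [← integral_const_mul, ← integral_indicator hE]
    refine integral_mono (hWi.indicator hE) (hinti.const_mul _) fun ω => ?_
    have hnn : 0 ≤ Real.exp 2 * (W ω * Real.exp (-2 * Y ω) *
        Real.exp (-2 * (B (s + 1) ω - B s ω))) := by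
      have := hW0 ω
      positivity
    by_cases hω : ω ∈ {ω | B (s + 1) ω < B s ω - Y ω + 1}
    · rw [Set.indicator_of_mem hω]
      have h3 : B (s + 1) ω < B s ω - Y ω + 1 := hω
      have h4 : 1 ≤ Real.exp (2 + (-2 * Y ω + -2 * (B (s + 1) ω - B s ω))) :=
        Real.one_le_exp (by linarith)
      rw [Real.exp_add, Real.exp_add] at h4
      calc W ω ≤ W ω * _ := le_mul_of_one_le_right (hW0 ω) h4
        _ = _ := by ring
    · rwa [Set.indicator_of_notMem hω]
  rw [hint] at key
  unfold expConst
  linarith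

/-- One-step drift of the potential `1 + exp (-(b * hgt y))` for a reflected Gaussian walk. -/
lemma integral_potential_step (hB : IsLinearBM μ B) {s b : ℝ} (hs : 0 ≤ s) (hb : 0 ≤ b)
    (hb1 : b ≤ 1) {W Y : Ω → ℝ} (hW : Measurable[pastSigma B s] W)
    (hW0 : ∀ ω, 0 ≤ W ω) (hWi : Integrable W μ) (hY : Measurable[pastSigma B s] Y)
    (hY0 : ∀ ω, 0 ≤ Y ω) :
    ∫ ω, W ω * (1 + Real.exp (-(b * hgt (max (Y ω + (B (s + 1) ω - B s ω)) 0)))) ∂μ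
        + b * (gainConst * Real.exp (-1)) * ∫ ω, W ω * Real.exp (-2 * Y ω) ∂μ
      ≤ (1 + remConst * b ^ 2) * ∫ ω, W ω * (1 + Real.exp (-(b * hgt (Y ω)))) ∂μ := by
  have hle := hB.pastSigma_le s
  have hst : s ≤ s + 1 := le_add_of_nonneg_right zero_le_one
  have h1 : Real.toNNReal (s + 1 - s) = 1 := by simp
  have hhgt : Measurable hgt := by unfold hgt; fun_prop
  have hgt0 : ∀ y, 0 ≤ y → 0 ≤ hgt y := fun y hy => add_nonneg hy (Real.exp_pos _).le
  have hrem : Measurable rem := by unfold rem; fun_prop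
  have hdom : ∀ f : Ω → ℝ, Measurable f → (∀ ω, 0 ≤ f ω) → (∀ ω, f ω ≤ 1) →
      Integrable (fun ω => W ω * f ω) μ := by
    intro f hf hf0 hf1
    refine hWi.mono ((hW.mono hle le_rfl).mul hf).aestronglyMeasurable (ae_of_all _ fun ω => ?_)
    rw [norm_mul, Real.norm_of_nonneg (hf0 ω)]
    exact mul_le_of_le_one_right (norm_nonneg _) (hf1 ω)
  set p : Ω → ℝ := fun ω => Real.exp (-(b * hgt (Y ω))) with hp
  set v : Ω → ℝ := fun ω => Real.exp (-Y ω) with hv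
  have hpm : Measurable[pastSigma B s] p :=
    Real.measurable_exp.comp ((hhgt.comp hY).const_mul b).neg
  have hvm : Measurable[pastSigma B s] v := Real.measurable_exp.comp hY.neg
  have hp0 : ∀ ω, 0 ≤ p ω := fun ω => (Real.exp_pos _).le
  have hp1 : ∀ ω, p ω ≤ 1 := fun ω =>
    Real.exp_le_one_iff.2 (neg_nonpos.2 (mul_nonneg hb (hgt0 _ (hY0 ω))))
  have hv0 : ∀ ω, 0 ≤ v ω := fun ω => (Real.exp_pos _).le
  have hv1 : ∀ ω, v ω ≤ 1 := fun ω => Real.exp_le_one_iff.2 (neg_nonpos.2 (hY0 ω))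
  set q : Ω → ℝ := fun ω =>
    Real.exp (-(b * hgt (max (Y ω + (B (s + 1) ω - B s ω)) 0))) with hq
  have hqm : Measurable q := by
    have h := (hY.mono hle le_rfl).add (hB.measurable_incr s (s + 1))
    exact Real.measurable_exp.comp ((hhgt.comp (h.max measurable_const)).const_mul b).neg
  have hq0 : ∀ ω, 0 ≤ q ω := fun ω => (Real.exp_pos _).le
  have hq1 : ∀ ω, q ω ≤ 1 := fun ω =>
    Real.exp_le_one_iff.2 (neg_nonpos.2 (mul_nonneg hb (hgt0 _ (le_max_right _ _))))
  have iWq := hdom q hqm hq0 hq1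
  have iWp := hdom p (hpm.mono hle le_rfl) hp0 hp1
  have iWpv := hdom (fun ω => p ω * v ω) ((hpm.mul hvm).mono hle le_rfl)
    (fun ω => mul_nonneg (hp0 ω) (hv0 ω)) (fun ω => mul_le_one₀ (hp1 ω) (hv0 ω) (hv1 ω))
  have iWp' : Integrable (fun ω => W ω * (p ω * (1 - v ω))) μ := by
    refine (iWp.sub iWpv).congr (ae_of_all _ fun ω => ?_)
    simp only [Pi.sub_apply]; ring
  have mWp : Measurable[pastSigma B s] fun ω => W ω * p ω := hW.mul hpm
  have mWpv : Measurable[pastSigma B s] fun ω => W ω * (p ω * v ω) := hW.mul (hpm.mul hvm)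
  have mWp' : Measurable[pastSigma B s] fun ω => W ω * (p ω * (1 - v ω)) :=
    hW.mul (hpm.mul (measurable_const.sub hvm))
  have e1 := hB.integral_mul_incr hs hst mWp' (g := fun x => x) measurable_id
  have e2 := hB.integral_mul_incr hs hst mWpv measurable_gain
  have e3 := hB.integral_mul_incr hs hst mWp hrem
  have i1 := hB.integrable_mul_incr hs hst mWp' iWp' (g := fun x => x) measurable_id
    (h1 ▸ integrable_id_gaussian)
  have i2 := hB.integrable_mul_incr hs hst mWpv iWpv measurable_gain (h1 ▸ integrable_gain)
  have i3 := hB.integrable_mul_incr hs hst mWp iWp hrem (h1 ▸ integrable_rem)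
  rw [h1] at e1 e2 e3
  rw [integral_id_gaussianReal, mul_zero] at e1
  rw [← gainConst] at e2
  rw [← remConst] at e3
  have j1 : Integrable (fun ω => W ω * p ω
      - b * (W ω * (p ω * (1 - v ω)) * (B (s + 1) ω - B s ω))) μ := iWp.sub (i1.const_mul b)
  have j2 : Integrable (fun ω => W ω * p ω
      - b * (W ω * (p ω * (1 - v ω)) * (B (s + 1) ω - B s ω))
      - b * (W ω * (p ω * v ω) * gain (B (s + 1) ω - B s ω))) μ := j1.sub (i2.const_mul b)
  have hstep : ∫ ω, W ω * q ω ∂μ ≤ ∫ ω, W ω * p ω ∂μ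
      - b * ((∫ ω, W ω * (p ω * v ω) ∂μ) * gainConst)
      + b ^ 2 * ((∫ ω, W ω * p ω ∂μ) * remConst) := by
    rw [← e2, ← e3, ← sub_zero (∫ ω, W ω * p ω ∂μ), ← mul_zero b, ← e1, ← integral_const_mul,
      ← integral_const_mul, ← integral_const_mul, ← integral_sub iWp (i1.const_mul b),
      ← integral_sub j1 (i2.const_mul b), ← integral_add j2 (i3.const_mul _)]
    refine integral_mono iWq (j2.add (i3.const_mul _)) fun ω => ?_
    have := mul_le_mul_of_nonneg_left
      (exp_neg_hgt_step (B (s + 1) ω - B s ω) hb hb1 (hY0 ω)) (hW0 ω)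
    refine this.trans (le_of_eq ?_)
    simp only [hp, hv]
    ring
  have hlow : Real.exp (-1) * ∫ ω, W ω * Real.exp (-2 * Y ω) ∂μ ≤ ∫ ω, W ω * (p ω * v ω) ∂μ := by
    rw [← integral_const_mul]
    refine integral_mono_of_nonneg (ae_of_all _ fun ω => ?_) iWpv (ae_of_all _ fun ω => ?_)
    · have := hW0 ω
      simp only [Pi.zero_apply]
      positivity
    · have h5 : Real.exp (-1) * Real.exp (-2 * Y ω) ≤ p ω * v ω := by
        simp only [hp, hv]
        rw [← Real.exp_add, ← Real.exp_add]
        refine Real.exp_le_exp.2 ?_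
        have h6 : hgt (Y ω) ≤ Y ω + 1 := by
          have := hv1 ω
          simp only [hv] at this
          unfold hgt; linarith
        have h7 : b * hgt (Y ω) ≤ hgt (Y ω) := mul_le_of_le_one_left (hgt0 _ (hY0 ω)) hb1
        linarith
      have := mul_le_mul_of_nonneg_left h5 (hW0 ω)
      simp only
      linarith
  have s1 : ∫ ω, W ω * (1 + q ω) ∂μ = ∫ ω, W ω ∂μ + ∫ ω, W ω * q ω ∂μ := by
    rw [← integral_add hWi iWq]; simp only [mul_add, mul_one]
  have s2 : ∫ ω, W ω * (1 + p ω) ∂μ = ∫ ω, W ω ∂μ + ∫ ω, W ω * p ω ∂μ := by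
    rw [← integral_add hWi iWp]; simp only [mul_add, mul_one]
  rw [s1, s2]
  have h8 := mul_le_mul_of_nonneg_left hlow (mul_nonneg hb gainConst_pos.le)
  have h9 : 0 ≤ remConst * b ^ 2 * ∫ ω, W ω ∂μ :=
    mul_nonneg (mul_nonneg remConst_nonneg (sq_nonneg b)) (integral_nonneg hW0)
  linarith

end IsLinearBM

/-- The random walk `k ↦ B k` reflected at its running minimum. -/
def reflWalk {Ω : Type*} (B : ℝ → Ω → ℝ) : ℕ → Ω → ℝ
  | 0, _ => 0
  | k + 1, ω => max (reflWalk B k ω + (B ((k : ℝ) + 1) ω - B k ω)) 0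

/-- The event that, on a grid of `[k, k + 1]` of mesh `1 / (N + 1)`, the path comes within
distance `1` of the minimum of `B 0, …, B k`. -/
def dipEvent {Ω : Type*} (B : ℝ → Ω → ℝ) (N k : ℕ) : Set Ω :=
  {ω | ∃ i < N + 2, B ((k : ℝ) + (i : ℝ) / ((N : ℝ) + 1)) ω < B k ω - reflWalk B k ω + 1}

/-- The exponential weight `(1 + a) ^ j`, where `j` is the number of events `dipEvent B N i` with
`i < k` that occur. -/
def dipWeight {Ω : Type*} (a : ℝ) (B : ℝ → Ω → ℝ) (N : ℕ) : ℕ → Ω → ℝ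
  | 0, _ => 1
  | k + 1, ω => dipWeight a B N k ω * (1 + a * (dipEvent B N k).indicator (fun _ => 1) ω)

section Walk

variable {Ω : Type*} {B : ℝ → Ω → ℝ}

lemma reflWalk_nonneg (k : ℕ) (ω : Ω) : 0 ≤ reflWalk B k ω := by
  cases k with
  | zero => exact le_rfl
  | succ k => exact le_max_right _ _

lemma reflWalk_le {x : ℝ} {ω : Ω} (k : ℕ) (h : ∀ i : ℕ, i ≤ k → x ≤ B i ω) :
    reflWalk B k ω ≤ B k ω - x := by
  induction k with
  | zero => simpa [reflWalk] using h 0 le_rfl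
  | succ k ih =>
    have h1 := ih fun i hi => h i (hi.trans k.le_succ)
    have h2 := h (k + 1) le_rfl
    push_cast at h2 ⊢
    exact max_le (by linarith) (by linarith)

lemma measurable_reflWalk (k : ℕ) : Measurable[pastSigma B k] (reflWalk B k) := by
  induction k with
  | zero => exact measurable_const
  | succ k ih =>
    have hk : (0 : ℝ) ≤ k := k.cast_nonneg
    rw [Nat.cast_succ]
    have h1 : Measurable[pastSigma B ((k : ℝ) + 1)] (B ((k : ℝ) + 1)) :=
      measurable_pastSigma (by linarith) le_rfl
    have h2 : Measurable[pastSigma B ((k : ℝ) + 1)] (B k) :=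
      measurable_pastSigma hk (by linarith)
    have h3 := ih.mono (pastSigma_mono (by linarith : (k : ℝ) ≤ k + 1)) le_rfl
    exact (h3.add (h1.sub h2)).max measurable_const

lemma grid_le {N i : ℕ} (k : ℕ) (hi : i < N + 2) :
    (k : ℝ) + (i : ℝ) / ((N : ℝ) + 1) ≤ k + 1 := by
  have : (i : ℝ) / ((N : ℝ) + 1) ≤ 1 := by
    rw [div_le_one (by positivity)]
    exact_mod_cast Nat.lt_succ_iff.1 hi
  linarith

lemma measurableSet_dipEvent (N k : ℕ) :
    MeasurableSet[pastSigma B ((k : ℝ) + 1)] (dipEvent B N k) := by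
  have hk : (0 : ℝ) ≤ k := k.cast_nonneg
  have h : dipEvent B N k = ⋃ i : Fin (N + 2), {ω | B ((k : ℝ) + (i : ℝ) / ((N : ℝ) + 1)) ω
      < B k ω - reflWalk B k ω + 1} := by
    ext ω; simp [dipEvent, Fin.exists_iff]
  rw [h]
  refine MeasurableSet.iUnion fun i => measurableSet_lt
    (measurable_pastSigma (by positivity) (grid_le k i.2)) ?_
  exact ((measurable_pastSigma hk (by linarith)).sub ((measurable_reflWalk k).mono
    (pastSigma_mono (by linarith)) le_rfl)).add_const 1

lemma measurable_dipWeight (a : ℝ) (N k : ℕ) :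
    Measurable[pastSigma B k] (dipWeight a B N k) := by
  induction k with
  | zero => exact measurable_const
  | succ k ih =>
    rw [Nat.cast_succ]
    refine (ih.mono (pastSigma_mono (by linarith : (k : ℝ) ≤ k + 1)) le_rfl).mul ?_
    exact measurable_const.add ((measurable_const.indicator
      (measurableSet_dipEvent N k)).const_mul a)

lemma dipWeight_nonneg {a : ℝ} (ha : 0 ≤ a) (N k : ℕ) (ω : Ω) : 0 ≤ dipWeight a B N k ω := by
  induction k with
  | zero => exact zero_le_one
  | succ k ih =>
    refine mul_nonneg ih (add_nonneg zero_le_one (mul_nonneg ha ?_))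
    exact Set.indicator_nonneg (fun _ _ => zero_le_one) ω

lemma dipWeight_le {a : ℝ} (ha : 0 ≤ a) (N k : ℕ) (ω : Ω) :
    dipWeight a B N k ω ≤ (1 + a) ^ k := by
  induction k with
  | zero => exact le_of_eq (pow_zero _).symm
  | succ k ih =>
    have h0 : 0 ≤ (dipEvent B N k).indicator (fun _ => (1 : ℝ)) ω :=
      Set.indicator_nonneg (fun _ _ => zero_le_one) ω
    have h1 : (dipEvent B N k).indicator (fun _ => (1 : ℝ)) ω ≤ 1 :=
      Set.indicator_le_self' (fun _ _ => zero_le_one) ω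
    rw [pow_succ]
    refine mul_le_mul ih ?_ (by positivity) (by positivity)
    nlinarith

lemma runMinCount_eq (n : ℕ) (ω : Ω) :
    runMinCount B n ω = ((Finset.Icc 1 n).filter fun k : ℕ =>
      ∃ t ∈ Set.Icc ((k : ℝ) - 1) (k : ℝ),
        B t ω = sInf ((fun s => B s ω) '' Set.Icc (0 : ℝ) t)).card := by
  unfold runMinCount
  rw [← Finset.card_image_of_injective _ (Nat.cast_injective (R := ℝ))]
  congr 1
  ext x
  simp only [Finset.mem_filter, Finset.mem_image, Finset.bind_def, Finset.pure_def,
    Finset.mem_sup, Finset.mem_singleton]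
  constructor
  · rintro ⟨⟨k, hk, rfl⟩, h⟩
    exact ⟨k, ⟨hk, h⟩, rfl⟩
  · rintro ⟨k, ⟨hk, h⟩, rfl⟩
    exact ⟨⟨k, hk, rfl⟩, h⟩

lemma runMinCount_succ (n : ℕ) (ω : Ω) :
    runMinCount B (n + 1) ω = runMinCount B n ω +
      if ∃ t ∈ Set.Icc (n : ℝ) ((n : ℝ) + 1),
        B t ω = sInf ((fun s => B s ω) '' Set.Icc (0 : ℝ) t) then 1 else 0 := by
  rw [runMinCount_eq, runMinCount_eq, ← Finset.insert_Icc_right_eq_Icc_add_one (by omega),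
    Finset.filter_insert]
  push_cast
  rw [add_sub_cancel_right]
  split_ifs
  · rw [Finset.card_insert_of_notMem (by simp)]
  · rfl

lemma pow_runMinCount_le {a : ℝ} (ha : 0 ≤ a) (N n : ℕ) (ω : Ω)
    (h : ∀ k < n, (∃ t ∈ Set.Icc (k : ℝ) ((k : ℝ) + 1),
      B t ω = sInf ((fun s => B s ω) '' Set.Icc (0 : ℝ) t)) → ω ∈ dipEvent B N k) :
    (1 + a) ^ runMinCount B n ω ≤ dipWeight a B N n ω := by
  induction n with
  | zero => simp [runMinCount, dipWeight]
  | succ n ih =>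
    have ih := ih fun k hk => h k (hk.trans n.lt_succ_self)
    rw [runMinCount_succ, pow_add]
    refine mul_le_mul ih ?_ (by positivity) (dipWeight_nonneg ha N n ω)
    split_ifs with hc
    · rw [Set.indicator_of_mem (h n n.lt_succ_self hc)]
      simp
    · rw [pow_zero]
      exact le_add_of_nonneg_right
        (mul_nonneg ha (Set.indicator_nonneg (fun _ _ => zero_le_one) ω))

lemma eventually_mem_dipEvent {ω : Ω} (hc : Continuous fun t => B t ω) (k : ℕ)
    (h : ∃ t ∈ Set.Icc (k : ℝ) ((k : ℝ) + 1),
      B t ω = sInf ((fun s => B s ω) '' Set.Icc (0 : ℝ) t)) :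
    ∀ᶠ N in atTop, ω ∈ dipEvent B N k := by
  obtain ⟨t, ⟨hkt, htk⟩, ht⟩ := h
  have hmin : ∀ s ∈ Set.Icc (0 : ℝ) t, B t ω ≤ B s ω := fun s hs => by
    rw [ht]
    exact csInf_le (isCompact_Icc.image hc).bddBelow ⟨s, hs, rfl⟩
  have hY : reflWalk B k ω ≤ B k ω - B t ω := reflWalk_le k fun i hi =>
    hmin i ⟨i.cast_nonneg, le_trans (by exact_mod_cast hi) hkt⟩
  have h1 : Tendsto (fun N : ℕ => (k : ℝ) + (⌊(t - k) * ((N : ℝ) + 1)⌋₊ : ℝ) / ((N : ℝ) + 1))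
      atTop (nhds t) := by
    have h2 := ((tendsto_nat_floor_mul_div_atTop (sub_nonneg.2 hkt)).comp
      (tendsto_atTop_add_const_right atTop (1 : ℝ) tendsto_natCast_atTop_atTop)).const_add
      (k : ℝ)
    rw [add_sub_cancel] at h2
    exact h2
  have h3 := ((hc.tendsto t).comp h1).eventually
    (gt_mem_nhds (show B t ω < B t ω + 1 by linarith))
  filter_upwards [h3] with N hN
  refine ⟨⌊(t - k) * ((N : ℝ) + 1)⌋₊, ?_, ?_⟩
  · have h4 : ⌊(t - k) * ((N : ℝ) + 1)⌋₊ ≤ N + 1 := by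
      refine Nat.floor_le_of_le ?_
      push_cast
      exact mul_le_of_le_one_left (by positivity) (by linarith)
    omega
  · have h5 : B ((k : ℝ) + (⌊(t - k) * ((N : ℝ) + 1)⌋₊ : ℝ) / ((N : ℝ) + 1)) ω < B t ω + 1 := hN
    linarith

end Walk

namespace IsLinearBM

variable {Ω : Type*} [mΩ : MeasurableSpace Ω] {μ : Measure Ω} {B : ℝ → Ω → ℝ}

lemma integrable_dipWeight [IsFiniteMeasure μ] (hB : IsLinearBM μ B) {a : ℝ} (ha : 0 ≤ a)
    (N k : ℕ) : Integrable (dipWeight a B N k) μ := by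
  refine Integrable.of_bound ((measurable_dipWeight a N k).mono (hB.pastSigma_le k)
    le_rfl).aestronglyMeasurable ((1 + a) ^ k) (ae_of_all _ fun ω => ?_)
  rw [Real.norm_of_nonneg (dipWeight_nonneg ha N k ω)]
  exact dipWeight_le ha N k ω

lemma integral_dipWeight_step [IsFiniteMeasure μ] (hB : IsLinearBM μ B) {a b : ℝ} (ha : 0 ≤ a)
    (hb : 0 ≤ b) (hb1 : b ≤ 1) (hab : 2 * a * expConst ≤ b * (gainConst * Real.exp (-1)))
    (N k : ℕ) :
    ∫ ω, dipWeight a B N (k + 1) ω * (1 + Real.exp (-(b * hgt (reflWalk B (k + 1) ω)))) ∂μ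
      ≤ (1 + remConst * b ^ 2) *
        ∫ ω, dipWeight a B N k ω * (1 + Real.exp (-(b * hgt (reflWalk B k ω)))) ∂μ := by
  have hk : (0 : ℝ) ≤ k := k.cast_nonneg
  have hWi := hB.integrable_dipWeight ha N k
  have hW0 := dipWeight_nonneg (B := B) ha N k
  have hWm := measurable_dipWeight (B := B) a N k
  have hYm := measurable_reflWalk (B := B) k
  have hY0 := reflWalk_nonneg (B := B) k
  have hDm := hB.pastSigma_le _ _ (measurableSet_dipEvent (B := B) N k)
  have h1 := hB.integral_potential_step hk hb hb1 hWm hW0 hWi hYm hY0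
  have h2 := hB.setIntegral_dip_le hk (τ := fun i => (k : ℝ) + (i : ℝ) / ((N : ℝ) + 1))
    (fun i j hij => by
      have : (i : ℝ) ≤ j := by exact_mod_cast hij
      dsimp only
      gcongr) (fun i => le_add_of_nonneg_right (by positivity)) hWm hW0 hWi hYm hY0 (N + 2)
    fun i hi => grid_le k hi
  change ∫ ω in dipEvent B N k, dipWeight a B N k ω ∂μ ≤ _ at h2
  set f : Ω → ℝ := fun ω => 1 + Real.exp (-(b * hgt (reflWalk B (k + 1) ω))) with hf
  have hf0 : ∀ ω, 0 ≤ f ω := fun ω => by positivity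
  have hf2 : ∀ ω, f ω ≤ 2 := fun ω => by
    have h3 : 0 ≤ hgt (reflWalk B (k + 1) ω) :=
      add_nonneg (reflWalk_nonneg _ _) (Real.exp_pos _).le
    have h4 : Real.exp (-(b * hgt (reflWalk B (k + 1) ω))) ≤ 1 :=
      Real.exp_le_one_iff.2 (neg_nonpos.2 (mul_nonneg hb h3))
    simp only [hf]
    linarith
  have hfm : Measurable f := by
    have h3 := (measurable_reflWalk (B := B) (k + 1)).mono (hB.pastSigma_le _) le_rfl
    have h4 : Measurable hgt := by unfold hgt; fun_prop
    exact (Real.measurable_exp.comp ((h4.comp h3).const_mul b).neg).const_add 1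
  have hi : Integrable (fun ω => dipWeight a B N k ω * f ω) μ := by
    refine hWi.mul_bdd (c := 2) hfm.aestronglyMeasurable (ae_of_all _ fun ω => ?_)
    rw [Real.norm_of_nonneg (hf0 ω)]
    exact hf2 ω
  have h3 : ∫ ω, dipWeight a B N (k + 1) ω * f ω ∂μ ≤ ∫ ω, dipWeight a B N k ω * f ω ∂μ
      + 2 * a * ∫ ω in dipEvent B N k, dipWeight a B N k ω ∂μ := by
    rw [← integral_indicator hDm, ← integral_const_mul,
      ← integral_add hi ((hWi.indicator hDm).const_mul _)]
    refine integral_mono_of_nonneg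
      (ae_of_all _ fun ω => mul_nonneg (dipWeight_nonneg ha N _ ω) (hf0 ω))
      (hi.add ((hWi.indicator hDm).const_mul _)) (ae_of_all _ fun ω => ?_)
    simp only [dipWeight]
    by_cases hω : ω ∈ dipEvent B N k
    · rw [Set.indicator_of_mem hω, Set.indicator_of_mem hω]
      have := mul_le_mul_of_nonneg_left (hf2 ω) (mul_nonneg ha (hW0 ω))
      linarith
    · rw [Set.indicator_of_notMem hω, Set.indicator_of_notMem hω]
      simp
  have h4 : 0 ≤ ∫ ω, dipWeight a B N k ω * Real.exp (-2 * reflWalk B k ω) ∂μ :=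
    integral_nonneg fun ω => mul_nonneg (hW0 ω) (Real.exp_pos _).le
  have h5 := mul_le_mul_of_nonneg_right hab h4
  have h6 := mul_le_mul_of_nonneg_left h2 (by positivity : 0 ≤ 2 * a)
  change ∫ ω, dipWeight a B N k ω * f ω ∂μ + _ ≤ _ at h1
  linarith

lemma integral_dipWeight_le [IsProbabilityMeasure μ] (hB : IsLinearBM μ B) {a b : ℝ} (ha : 0 ≤ a)
    (hb : 0 ≤ b) (hb1 : b ≤ 1) (hab : 2 * a * expConst ≤ b * (gainConst * Real.exp (-1)))
    (N n : ℕ) :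
    ∫ ω, dipWeight a B N n ω ∂μ ≤ 2 * (1 + remConst * b ^ 2) ^ n := by
  have hr : 0 ≤ 1 + remConst * b ^ 2 := by
    have := remConst_nonneg
    positivity
  have h : ∀ k, ∫ ω, dipWeight a B N k ω * (1 + Real.exp (-(b * hgt (reflWalk B k ω)))) ∂μ
      ≤ 2 * (1 + remConst * b ^ 2) ^ k := by
    intro k
    induction k with
    | zero =>
      have : Real.exp (-b) ≤ 1 := Real.exp_le_one_iff.2 (by linarith)
      simp only [dipWeight, reflWalk, hgt, integral_const, probReal_univ, one_smul]
      simp only [neg_zero, Real.exp_zero, zero_add, mul_one, one_mul, pow_zero]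
      linarith
    | succ k ih =>
      refine (hB.integral_dipWeight_step ha hb hb1 hab N k).trans ?_
      rw [pow_succ (1 + remConst * b ^ 2)]
      have := mul_le_mul_of_nonneg_left ih hr
      linarith
  refine le_trans ?_ (h n)
  refine integral_mono_of_nonneg (ae_of_all _ (dipWeight_nonneg ha N n)) ?_
    (ae_of_all _ fun ω => le_mul_of_one_le_right (dipWeight_nonneg ha N n ω) ?_)
  · refine (hB.integrable_dipWeight ha N n).mul_bdd (c := 2) ?_ (ae_of_all _ fun ω => ?_)
    · have h3 := (measurable_reflWalk (B := B) n).mono (hB.pastSigma_le _) le_rfl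
      have h4 : Measurable hgt := by unfold hgt; fun_prop
      exact ((Real.measurable_exp.comp
        ((h4.comp h3).const_mul b).neg).const_add 1).aestronglyMeasurable
    · have h3 : 0 ≤ hgt (reflWalk B n ω) :=
        add_nonneg (reflWalk_nonneg _ _) (Real.exp_pos _).le
      have h4 : Real.exp (-(b * hgt (reflWalk B n ω))) ≤ 1 :=
        Real.exp_le_one_iff.2 (neg_nonpos.2 (mul_nonneg hb h3))
      rw [Real.norm_of_nonneg (by positivity)]
      linarith
  · have := Real.exp_pos (-(b * hgt (reflWalk B n ω)))
    linarith

end IsLinearBM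

lemma measure_le_of_eventually_mem {Ω : Type*} [MeasurableSpace Ω] {μ : Measure Ω} {E : Set Ω}
    {F : ℕ → Set Ω} {ε : ℝ≥0∞} (hE : ∀ᵐ ω ∂μ, ω ∈ E → ∀ᶠ N in atTop, ω ∈ F N)
    (hF : ∀ N, μ (F N) ≤ ε) : μ E ≤ ε := by
  have h1 : μ E ≤ μ (⋃ M, ⋂ N ≥ M, F N) := by
    refine measure_mono_ae ?_
    filter_upwards [hE] with ω h hω
    obtain ⟨M, hM⟩ := eventually_atTop.1 (h hω)
    exact Set.mem_iUnion.2 ⟨M, Set.mem_iInter₂.2 hM⟩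
  refine h1.trans ?_
  have hmono : Monotone fun M => ⋂ N ≥ M, F N := fun M M' h =>
    Set.biInter_mono (fun N hN => le_trans h hN) fun _ _ => le_rfl
  rw [hmono.measure_iUnion]
  exact iSup_le fun M => (measure_mono (Set.biInter_subset_of_mem (le_refl M))).trans (hF M)

lemma exp_half_le_one_add {a : ℝ} (ha : 0 ≤ a) (ha1 : a ≤ 1) : Real.exp (a / 2) ≤ 1 + a := by
  have h1 := Real.one_sub_le_exp_neg (a / 2)
  have h2 : Real.exp (a / 2) * Real.exp (-(a / 2)) = 1 := by rw [← Real.exp_add]; simp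
  have h3 := Real.exp_pos (a / 2)
  have h4 : Real.exp (a / 2) * (1 - a / 2) ≤ (1 + a) * (1 - a / 2) := by nlinarith
  exact le_of_mul_le_mul_right h4 (by linarith)

theorem stmt9 :
    ∃ c₁ c₂ : ℝ, 0 < c₁ ∧ 0 < c₂ ∧
      ∀ (Ω : Type) [MeasurableSpace Ω] (μ : Measure Ω), IsProbabilityMeasure μ →
        ∀ B : ℝ → Ω → ℝ, IsLinearBM μ B →
          ∀ n m : ℕ, 1 ≤ n → 1 ≤ m →
            μ {ω | m < runMinCount B n ω} ≤
              ENNReal.ofReal (c₁ * Real.exp (-(c₂ * m / Real.sqrt n))) := by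
  set c : ℝ := min 1 (gainConst * Real.exp (-1) / (2 * expConst)) with hc
  have hexp := expConst_pos
  have hc0 : 0 < c := lt_min one_pos
    (div_pos (mul_pos gainConst_pos (Real.exp_pos _)) (by positivity))
  refine ⟨2 * Real.exp remConst, c / 2, by positivity, by positivity, ?_⟩
  intro Ω _ μ _ B hB n m hn _
  set b : ℝ := 1 / Real.sqrt n with hbd
  have hn0 : (0 : ℝ) < n := by exact_mod_cast hn
  have hsq : 1 ≤ Real.sqrt n := Real.one_le_sqrt.2 (by exact_mod_cast hn)
  have hb0 : 0 < b := by positivity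
  have hb1 : b ≤ 1 := by rw [hbd, div_le_one (by positivity)]; exact hsq
  have hb2 : b ^ 2 = 1 / n := by rw [hbd, div_pow, Real.sq_sqrt hn0.le, one_pow]
  set a : ℝ := c * b with had
  have ha0 : 0 < a := by positivity
  have ha1 : a ≤ 1 := mul_le_one₀ (min_le_left _ _) hb0.le hb1
  have hab : 2 * a * expConst ≤ b * (gainConst * Real.exp (-1)) := by
    have h : c * (2 * expConst) ≤ gainConst * Real.exp (-1) :=
      (le_div_iff₀ (by positivity)).1 (min_le_right _ _)
    have := mul_le_mul_of_nonneg_left h hb0.le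
    rw [had]
    linarith
  have hpow : (1 + remConst * b ^ 2) ^ n ≤ Real.exp remConst := by
    have hr := remConst_nonneg
    have h : 1 + remConst * b ^ 2 ≤ Real.exp (remConst / n) := by
      have := Real.add_one_le_exp (remConst / n)
      rw [hb2, mul_one_div]
      linarith
    refine (pow_le_pow_left₀ (by positivity) h n).trans (le_of_eq ?_)
    rw [← Real.exp_nat_mul]
    congr 1
    field_simp
  refine measure_le_of_eventually_mem (F := fun N => {ω | (1 + a) ^ m ≤ dipWeight a B N n ω}) ?_ ?_
  · filter_upwards [hB.cont] with ω hω hm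
    have h : ∀ᶠ N in atTop, ∀ k ∈ Finset.range n, (∃ t ∈ Set.Icc (k : ℝ) ((k : ℝ) + 1),
        B t ω = sInf ((fun s => B s ω) '' Set.Icc (0 : ℝ) t)) → ω ∈ dipEvent B N k := by
      rw [eventually_all_finset]
      intro k _
      by_cases h : ∃ t ∈ Set.Icc (k : ℝ) ((k : ℝ) + 1),
        B t ω = sInf ((fun s => B s ω) '' Set.Icc (0 : ℝ) t)
      · exact (eventually_mem_dipEvent hω k h).mono fun _ hN _ => hN
      · exact Eventually.of_forall fun _ h' => absurd h' h
    filter_upwards [h] with N hN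
    refine le_trans ?_ (pow_runMinCount_le ha0.le N n ω fun k hk => hN k (Finset.mem_range.2 hk))
    exact pow_le_pow_right₀ (by linarith) (le_of_lt hm)
  · intro N
    have h1 := mul_meas_ge_le_integral_of_nonneg (ae_of_all μ (dipWeight_nonneg ha0.le N n))
      (hB.integrable_dipWeight ha0.le N n) ((1 + a) ^ m)
    have h2 := h1.trans ((hB.integral_dipWeight_le ha0.le hb0.le hb1 hab N n).trans
      (mul_le_mul_of_nonneg_left hpow zero_le_two))
    rw [← ofReal_measureReal]
    refine ENNReal.ofReal_le_ofReal ?_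
    have h3 : Real.exp (c / 2 * m / Real.sqrt n) ≤ (1 + a) ^ m := by
      refine le_trans (le_of_eq ?_)
        (pow_le_pow_left₀ (Real.exp_pos _).le (exp_half_le_one_add ha0.le ha1) m)
      rw [← Real.exp_nat_mul, had, hbd]
      congr 1
      ring
    rw [Real.exp_neg, ← div_eq_mul_inv, le_div_iff₀ (Real.exp_pos _), mul_comm]
    exact (mul_le_mul_of_nonneg_right h3 measureReal_nonneg).trans h2
end
end

section
/- Suppose P : ℂ → Prob(C([0,∞),ℂ)) is continuous and defines a Markovian time-changed Brownian motion. Then for every λ > 0 and every bounded Borel measurable f : ℂ → ℝ, the resolvent R^λ f is a continuous function on ℂ; in particular, P is strongly Feller. -/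
open MeasureTheory ProbabilityTheory Filter Topology
open scoped ENNReal NNReal

noncomputable section

instance : BorelSpace PathSp := ⟨rfl⟩

/-- The centered planar Gaussian law on `ℂ` with covariance matrix `v·I₂`. -/
def planarGaussian (v : ℝ≥0) : Measure ℂ :=
  ((gaussianReal 0 v).prod (gaussianReal 0 v)).map fun p => Complex.equivRealProd.symm p

/-- `B` is a standard planar Brownian motion on `(Ω, μ)` started from `z`: it starts at `z`,
has continuous sample paths, and for `s ≤ t` the increment `B_t − B_s` is independent of
`(B_u)_{u ≤ s}` and centered Gaussian with covariance matrix `(t−s)·I₂`. -/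
structure IsPlanarBM {Ω : Type*} [MeasurableSpace Ω] (μ : Measure Ω)
    (B : ℝ≥0 → Ω → ℂ) (z : ℂ) : Prop where
  meas : ∀ t : ℝ≥0, Measurable (B t)
  start : ∀ᵐ ω ∂μ, B 0 ω = z
  cont : ∀ᵐ ω ∂μ, Continuous fun t => B t ω
  indep : ∀ s t : ℝ≥0, s ≤ t →
    Indep (MeasurableSpace.comap (fun ω => B t ω - B s ω) inferInstance)
      (⨆ u ∈ Set.Iic s, MeasurableSpace.comap (B u) inferInstance) μ
  incr : ∀ s t : ℝ≥0, s ≤ t → μ.map (fun ω => B t ω - B s ω) = planarGaussian (t - s)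

/-- Shift of a path by time `s`: `(pathShift s X) t = X (s + t)`. -/
def pathShift (s : ℝ≥0) (X : PathSp) : PathSp :=
  X.comp ⟨fun t => s + t, continuous_add_left s⟩

/-- The σ-algebra on path space generated by the coordinates `(X_u)_{0 ≤ u ≤ s}`. -/
def pastAlg (s : ℝ≥0) : MeasurableSpace PathSp :=
  ⨆ u ∈ Set.Iic s, MeasurableSpace.comap (fun X : PathSp => X u) inferInstance

/-- Each `P_z` is supported on paths starting at `z`. -/
def StartsAt (P : ℂ → ProbabilityMeasure PathSp) : Prop :=
  ∀ z : ℂ, (P z : Measure PathSp) {X : PathSp | X 0 = z} = 1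

/-- `P` is Markovian: for each `z` and `s ≥ 0`, the conditional law under `P_z` of the
shifted path `(X_{s+t})_{t ≥ 0}` given the past `(X_u)_{0 ≤ u ≤ s}` is almost surely
`P_{X_s}`, expressed by integration against events of the past σ-algebra. -/
def IsMarkovian (P : ℂ → ProbabilityMeasure PathSp) : Prop :=
  ∀ (z : ℂ) (s : ℝ≥0) (A : Set PathSp), MeasurableSet[pastAlg s] A →
    ∀ g : PathSp → ℝ, Measurable g → (∃ C : ℝ, ∀ X, |g X| ≤ C) →
      ∫ X in A, g (pathShift s X) ∂(P z : Measure PathSp) =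
        ∫ X in A, (∫ Y, g Y ∂(P (X s) : Measure PathSp)) ∂(P z : Measure PathSp)

/-- `(Ω, μ, B, τ, F)` realizes `ν` as a time-changed Brownian motion started from `z`:
`B` is a planar Brownian motion started at `z`, `τ` is a random continuous strictly
increasing time change with `τ_0 = 0` and `τ_u → ∞`, and the path `u ↦ B_{τ_u}`
(represented by the random continuous path `F`) has law `ν`. -/
def Realizes {Ω : Type} [MeasurableSpace Ω] (μ : Measure Ω) (B : ℝ≥0 → Ω → ℂ)
    (τ : ℝ≥0 → Ω → ℝ≥0) (F : Ω → PathSp) (z : ℂ) (ν : Measure PathSp) : Prop :=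
  IsProbabilityMeasure μ ∧ IsPlanarBM μ B z ∧
  (∀ᵐ ω ∂μ, τ 0 ω = 0 ∧ StrictMono (fun u => τ u ω) ∧
    Continuous (fun u => τ u ω) ∧ Tendsto (fun u => τ u ω) atTop atTop) ∧
  Measurable F ∧ (∀ᵐ ω ∂μ, ∀ u : ℝ≥0, F ω u = B (τ u ω) ω) ∧
  μ.map F = ν

/-- `P` is a time-changed Brownian motion: for each `z`, a process with law `P_z` can be
realized as `X_u = B_{τ_u}` for a planar Brownian motion `B` started from `z` and a random
continuous strictly increasing time change `τ` with `τ_0 = 0` and `τ_u → ∞`. -/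
def IsTimeChangedBM (P : ℂ → ProbabilityMeasure PathSp) : Prop :=
  ∀ z : ℂ, ∃ (Ω : Type) (mΩ : MeasurableSpace Ω) (μ : @Measure Ω mΩ)
    (B : ℝ≥0 → Ω → ℂ) (τ : ℝ≥0 → Ω → ℝ≥0) (F : Ω → PathSp),
      @Realizes Ω mΩ μ B τ F z (P z : Measure PathSp)

/-- `P` defines a Markovian time-changed Brownian motion. -/
def DefinesMTCBM (P : ℂ → ProbabilityMeasure PathSp) : Prop :=
  StartsAt P ∧ IsMarkovian P ∧ IsTimeChangedBM P

/-- The Borel measure `μ` on `ℂ` is invariant for `P`. -/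
def InvariantFor (P : ℂ → ProbabilityMeasure PathSp) (μ : Measure ℂ) : Prop :=
  ∀ (t : ℝ≥0) (A : Set ℂ), MeasurableSet A →
    ∫⁻ z, (P z : Measure PathSp) {X : PathSp | X t ∈ A} ∂μ = μ A

/-- The resolventOp `R^λ f (z) = ∫_0^∞ e^{−λt} E_{P_z}[f(X_t)] dt`. -/
def resolventOp (P : ℂ → ProbabilityMeasure PathSp) (l : ℝ) (f : ℂ → ℝ) (z : ℂ) : ℝ :=
  ∫ t in Set.Ioi (0 : ℝ),
    Real.exp (-(l * t)) * ∫ X, f (X t.toNNReal) ∂(P z : Measure PathSp)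

/-- `T` is the time at which the path `x` leaves the closed ball of radius `r` about `z`. -/
structure IsExitTime (x : ℝ≥0 → ℂ) (z : ℂ) (r : ℝ) (T : ℝ≥0) : Prop where
  before : ∀ t < T, ‖x t - z‖ ≤ r
  after : ∀ b, T < b → ∃ t < b, r < ‖x t - z‖

lemma IsExitTime.norm_le {x : ℝ≥0 → ℂ} {z : ℂ} {r : ℝ} {T : ℝ≥0} (h : IsExitTime x z r T)
    (hx : Continuous x) (h0 : ‖x 0 - z‖ ≤ r) {t : ℝ≥0} (ht : t ≤ T) : ‖x t - z‖ ≤ r := by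
  rcases eq_or_ne T 0 with rfl | hT
  · rwa [le_antisymm ht bot_le]
  have hcl : IsClosed {t | ‖x t - z‖ ≤ r} :=
    isClosed_le (hx.sub continuous_const).norm continuous_const
  have h1 := closure_minimal (s := Set.Iio T) (fun s hs => h.before s hs) hcl
  rw [closure_Iio' ⟨0, pos_iff_ne_zero.2 hT⟩] at h1
  exact h1 ht

lemma IsExitTime.le_norm {x : ℝ≥0 → ℂ} {z : ℂ} {r : ℝ} {T : ℝ≥0} (h : IsExitTime x z r T)
    (hx : Continuous x) : r ≤ ‖x T - z‖ := by
  by_contra! hlt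
  have h1 : ∀ᶠ t in 𝓝 T, ‖x t - z‖ < r :=
    (hx.sub continuous_const).norm.continuousAt.eventually (gt_mem_nhds hlt)
  obtain ⟨b, hb, hTb⟩ := exists_Ico_subset_of_mem_nhds h1 ⟨T + 1, by simp⟩
  obtain ⟨t, htb, ht⟩ := h.after b hb
  rcases lt_or_ge t T with h2 | h2
  · exact absurd (h.before t h2) (not_le.2 ht)
  · exact lt_asymm ht (hTb ⟨h2, htb⟩)

lemma IsExitTime.norm_eq {x : ℝ≥0 → ℂ} {z : ℂ} {r : ℝ} {T : ℝ≥0} (h : IsExitTime x z r T)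
    (hx : Continuous x) (h0 : ‖x 0 - z‖ ≤ r) : ‖x T - z‖ = r :=
  le_antisymm (h.norm_le hx h0 le_rfl) (h.le_norm hx)

/-- The first time of the grid `ℕ / (n + 1)` at which `Y` is outside the closed ball of radius `r`
about `z`, capped at `N`. -/
def gridExit {Ω : Type*} (Y : ℝ≥0 → Ω → ℂ) (z : ℂ) (r : ℝ) (N n : ℕ) (ω : Ω) : ℝ≥0 :=
  (hittingBtwn (fun (j : ℕ) ω => Y ((j : ℝ≥0) / (n + 1)) ω) {y | r < ‖y - z‖} 0 (N * (n + 1)) ω : ℕ)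
    / ((n : ℝ≥0) + 1)

lemma tendsto_gridExit {Ω : Type*} {Y : ℝ≥0 → Ω → ℂ} {z : ℂ} {r : ℝ} {ω : Ω} {T : ℝ≥0}
    (hc : Continuous fun t => Y t ω) (hT : IsExitTime (fun t => Y t ω) z r T) (N : ℕ) :
    Tendsto (fun n => gridExit Y z r N n ω) atTop (𝓝 (min T N)) := by
  have hpos : ∀ n : ℕ, (0 : ℝ≥0) < (n : ℝ≥0) + 1 := fun n => by positivity
  have hle : ∀ n, gridExit Y z r N n ω ≤ N := fun n => by
    rw [gridExit, div_le_iff₀ (hpos n)]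
    have h := hittingBtwn_le (u := fun (j : ℕ) ω => Y ((j : ℝ≥0) / (n + 1)) ω)
      (s := {y | r < ‖y - z‖}) (n := 0) (m := N * (n + 1)) ω
    exact_mod_cast h
  have hge : ∀ n, min T N ≤ gridExit Y z r N n ω := fun n => by
    by_contra! h
    have h1 : gridExit Y z r N n ω < N := h.trans_le (min_le_right _ _)
    have h2 := hT.before _ (h.trans_le (min_le_left _ _))
    have h3 : hittingBtwn (fun (j : ℕ) ω => Y ((j : ℝ≥0) / (n + 1)) ω) {y | r < ‖y - z‖} 0
        (N * (n + 1)) ω < N * (n + 1) := by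
      rw [gridExit, div_lt_iff₀ (hpos n)] at h1
      exact_mod_cast h1
    have h4 := hittingBtwn_mem_set_of_hittingBtwn_lt h3
    exact absurd h2 (not_le.2 h4)
  rcases le_or_gt (N : ℝ≥0) T with h | h
  · rw [min_eq_right h] at hge ⊢
    exact tendsto_const_nhds.congr fun n => le_antisymm (hge n) (hle n)
  rw [min_eq_left h.le] at hge ⊢
  refine tendsto_order.2 ⟨fun a ha => Eventually.of_forall fun n => ha.trans_le (hge n),
    fun b hb => ?_⟩
  obtain ⟨t, htb, ht⟩ := hT.after (min b N) (lt_min hb h)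
  have h1 : Tendsto (fun n : ℕ => (⌈(t : ℝ) * ((n : ℝ) + 1)⌉₊ : ℝ≥0) / ((n : ℝ≥0) + 1)) atTop (𝓝 t) := by
    have := (tendsto_nat_ceil_mul_div_atTop (R := ℝ) (a := t) t.2).comp
      (tendsto_natCast_atTop_atTop.comp (tendsto_add_atTop_nat 1))
    refine NNReal.tendsto_coe.1 (this.congr fun n => ?_)
    simp
  have h2 := (h1.eventually (gt_mem_nhds htb)).and
    (h1.eventually ((hc.sub continuous_const).norm.continuousAt.eventually (lt_mem_nhds ht)))
  filter_upwards [h2] with n hn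
  have hn1 := lt_min_iff.1 hn.1
  refine lt_of_le_of_lt ?_ hn1.1
  rw [gridExit]
  gcongr
  refine hittingBtwn_le_of_mem (Nat.zero_le _) ?_ hn.2
  have := hn1.2
  rw [div_lt_iff₀ (hpos n)] at this
  exact_mod_cast this.le

/-- Optional stopping at the exit time of a closed ball, for a closed martingale with continuous
paths which is bounded up to that time. -/
lemma integral_stopped_exit {Ω : Type*} {m : MeasurableSpace Ω} {μ : Measure Ω}
    [IsProbabilityMeasure μ] (F : Filtration ℝ≥0 m) {Z : Ω → ℝ} (hZ : Integrable Z μ)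
    {M : ℝ≥0 → Ω → ℝ} (N : ℕ) (hM : ∀ t ≤ (N : ℝ≥0), M t =ᵐ[μ] μ[Z | F t])
    (hMc : ∀ᵐ ω ∂μ, Continuous fun t => M t ω)
    {Y : ℝ≥0 → Ω → ℂ} (hY : ∀ t, Measurable[F t] (Y t)) (hYc : ∀ᵐ ω ∂μ, Continuous fun t => Y t ω)
    {z : ℂ} {r : ℝ} {T : Ω → ℝ≥0} (hT : ∀ᵐ ω ∂μ, IsExitTime (fun t => Y t ω) z r (T ω))
    {K : ℝ} (hK : ∀ᵐ ω ∂μ, |M (min (T ω) N) ω| ≤ K) :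
    AEStronglyMeasurable (fun ω => M (min (T ω) N) ω) μ ∧
      ∫ ω, M (min (T ω) N) ω ∂μ = ∫ ω, Z ω ∂μ := by
  have key : ∀ n : ℕ, ∃ G : MeasurableSpace Ω, G ≤ m ∧
      (fun ω => M (gridExit Y z r N n ω) ω) =ᵐ[μ] μ[Z | G] := by
    intro n
    have hpos : (0 : ℝ≥0) < (n : ℝ≥0) + 1 := by positivity
    let F' : Filtration ℕ m := ⟨fun j => F ((j : ℝ≥0) / (n + 1)), fun i j hij => F.mono (by
      gcongr), fun j => F.le _⟩
    have hst := Adapted.isStoppingTime_hittingBtwn (f := F') (n := 0) (n' := N * (n + 1))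
      (u := fun (j : ℕ) ω => Y ((j : ℝ≥0) / (n + 1)) ω) (s := {y | r < ‖y - z‖})
      (fun j => hY _) (measurableSet_lt measurable_const (by fun_prop))
    have hle : ∀ ω, ((hittingBtwn (fun (j : ℕ) ω => Y ((j : ℝ≥0) / (n + 1)) ω)
        {y | r < ‖y - z‖} 0 (N * (n + 1)) ω : ℕ) : WithTop ℕ) ≤ ((N * (n + 1) : ℕ) : WithTop ℕ) :=
      fun ω => WithTop.coe_le_coe.2 (hittingBtwn_le ω)
    refine ⟨hst.measurableSpace, hst.measurableSpace_le, ?_⟩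
    have h1 := (martingale_condExp Z F' μ).stoppedValue_ae_eq_condExp_of_le_const hst hle
    have h2 : μ[μ[Z | F' (N * (n + 1))] | hst.measurableSpace] =ᵐ[μ] μ[Z | hst.measurableSpace] :=
      condExp_condExp_of_le (hst.measurableSpace_le_of_le_const hle) (F'.le _)
    refine EventuallyEq.trans ?_ (h1.trans h2)
    have h3 : ∀ᵐ ω ∂μ, ∀ j : ℕ, j ≤ N * (n + 1) →
        M ((j : ℝ≥0) / (n + 1)) ω = (μ[Z | F' j]) ω := by
      rw [ae_all_iff]
      intro j
      by_cases hj : j ≤ N * (n + 1)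
      · filter_upwards [hM ((j : ℝ≥0) / (n + 1)) (by
          rw [div_le_iff₀ hpos]; exact_mod_cast hj)] with ω hω _
        exact hω
      · exact Eventually.of_forall fun ω h => absurd h hj
    filter_upwards [h3] with ω hω
    exact hω _ (hittingBtwn_le ω)
  choose G hG hMG using key
  have hlim : ∀ᵐ ω ∂μ, Tendsto (fun n => M (gridExit Y z r N n ω) ω) atTop
      (𝓝 (M (min (T ω) N) ω)) := by
    filter_upwards [hMc, hYc, hT] with ω h1 h2 h3
    exact (h1.tendsto _).comp (tendsto_gridExit h2 h3 N)
  have hmeas : ∀ n, AEStronglyMeasurable (fun ω => M (gridExit Y z r N n ω) ω) μ := fun n =>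
    ((stronglyMeasurable_condExp.mono (hG n)).aestronglyMeasurable).congr (hMG n).symm
  have hlm : AEStronglyMeasurable (fun ω => M (min (T ω) N) ω) μ :=
    aestronglyMeasurable_of_tendsto_ae atTop hmeas hlim
  have hmem : MemLp (fun ω => M (min (T ω) N) ω) 1 μ :=
    MemLp.of_bound hlm K (by simpa using hK)
  have hui : UnifIntegrable (fun n ω => M (gridExit Y z r N n ω) ω) 1 μ :=
    (hZ.uniformIntegrable_condExp hG).unifIntegrable.ae_eq fun n => (hMG n).symm
  have hL := tendsto_Lp_finite_of_tendsto_ae le_rfl ENNReal.one_ne_top hmeas hmem hui hlim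
  have h_int : ∀ n, ∫ ω, M (gridExit Y z r N n ω) ω ∂μ = ∫ ω, Z ω ∂μ := fun n => by
    rw [integral_congr_ae (hMG n), integral_condExp (hG n)]
  have hI := tendsto_integral_of_L1' _ hlm
    (Eventually.of_forall fun n => integrable_condExp.congr (hMG n).symm) hL
  simp only [h_int] at hI
  exact ⟨hlm, tendsto_nhds_unique hI tendsto_const_nhds⟩

lemma measurable_equivRealProd_symm :
    Measurable fun p : ℝ × ℝ => Complex.equivRealProd.symm p :=
  Complex.measurableEquivRealProd.symm.measurable

instance (v : ℝ≥0) : IsProbabilityMeasure (planarGaussian v) :=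
  Measure.isProbabilityMeasure_map measurable_equivRealProd_symm.aemeasurable

lemma integrable_cexp_mul_gaussianReal (a : ℂ) (v : ℝ≥0) :
    Integrable (fun x : ℝ => Complex.exp (a * x)) (gaussianReal 0 v) := by
  rw [← integrable_norm_iff (by fun_prop)]
  simpa [Complex.norm_exp] using integrable_exp_mul_gaussianReal a.re

lemma cexp_mul_equivRealProd_symm (a : ℂ) (p : ℝ × ℝ) :
    Complex.exp (a * Complex.equivRealProd.symm p)
      = Complex.exp (a * p.1) * Complex.exp (a * Complex.I * p.2) := by
  rw [← Complex.exp_add, Complex.equivRealProd_symm_apply]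
  ring_nf

lemma integrable_cexp_mul_planarGaussian (a : ℂ) (v : ℝ≥0) :
    Integrable (fun y => Complex.exp (a * y)) (planarGaussian v) := by
  rw [planarGaussian, integrable_map_measure (by fun_prop) measurable_equivRealProd_symm.aemeasurable]
  simp only [Function.comp_def, cexp_mul_equivRealProd_symm]
  exact
    (integrable_cexp_mul_gaussianReal a v).mul_prod
      (integrable_cexp_mul_gaussianReal (a * Complex.I) v)

lemma integral_cexp_mul_planarGaussian (a : ℂ) (v : ℝ≥0) :
    ∫ y, Complex.exp (a * y) ∂planarGaussian v = 1 := by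
  rw [planarGaussian, integral_map measurable_equivRealProd_symm.aemeasurable (by fun_prop)]
  simp only [cexp_mul_equivRealProd_symm]
  rw [integral_prod_mul (fun x : ℝ => Complex.exp (a * x))
    (fun x : ℝ => Complex.exp (a * Complex.I * x))]
  have h := fun z => complexMGF_gaussianReal (p := gaussianReal 0 v) (X := id) (μ := 0) (v := v)
    Measure.map_id z
  simp only [complexMGF, id] at h
  rw [h, h, ← Complex.exp_add, mul_pow, Complex.I_sq]
  simp
  ring_nf
  simp

lemma planarGaussian_norm_le (v : ℝ≥0) (hv : v ≠ 0) (ρ : ℝ) :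
    planarGaussian v {y | ‖y‖ ≤ ρ} ≤
      ENNReal.ofReal (√(2 * Real.pi * v))⁻¹ * ENNReal.ofReal (2 * ρ) := by
  have hm : MeasurableSet {y : ℂ | ‖y‖ ≤ ρ} := measurableSet_le measurable_norm measurable_const
  rw [planarGaussian, Measure.map_apply measurable_equivRealProd_symm hm]
  calc _ ≤ ((gaussianReal 0 v).prod (gaussianReal 0 v)) (Set.Icc (-ρ) ρ ×ˢ Set.univ) := by
        refine measure_mono fun p hp => ⟨?_, trivial⟩
        have h := (Complex.abs_re_le_norm _).trans hp
        simpa [abs_le] using h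
    _ = gaussianReal 0 v (Set.Icc (-ρ) ρ) := by simp [Measure.prod_prod]
    _ ≤ ∫⁻ x in Set.Icc (-ρ) ρ, ENNReal.ofReal (√(2 * Real.pi * v))⁻¹ := by
        rw [gaussianReal_apply _ hv]
        refine lintegral_mono fun x => ENNReal.ofReal_le_ofReal ?_
        rw [gaussianPDFReal]
        refine mul_le_of_le_one_right (by positivity) (Real.exp_le_one_iff.2 ?_)
        rw [neg_div, neg_nonpos]
        positivity
    _ = _ := by
        rw [setLIntegral_const, Real.volume_Icc]
        ring_nf

namespace IsPlanarBM

variable {Ω : Type*} [mΩ : MeasurableSpace Ω] {μ : Measure Ω} {B : ℝ≥0 → Ω → ℂ} {w : ℂ}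

/-- The natural filtration of a planar Brownian motion. -/
def filtration (h : IsPlanarBM μ B w) : Filtration ℝ≥0 mΩ where
  seq s := ⨆ u ∈ Set.Iic s, MeasurableSpace.comap (B u) inferInstance
  mono' _ _ hst := biSup_mono fun _ hu => le_trans hu hst
  le' _ := iSup₂_le fun u _ => (h.meas u).comap_le

lemma measurable_filtration (h : IsPlanarBM μ B w) (t : ℝ≥0) : Measurable[h.filtration t] (B t) :=
  Measurable.mono (comap_measurable (B t))
    (le_iSup₂_of_le (f := fun u (_ : u ∈ Set.Iic t) => MeasurableSpace.comap (B u) inferInstance)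
      t (Set.mem_Iic.2 le_rfl) le_rfl) le_rfl

lemma measurable_incr (h : IsPlanarBM μ B w) (s t : ℝ≥0) : Measurable fun ω => B t ω - B s ω :=
  (h.meas t).sub (h.meas s)

lemma measure_norm_sub_le (h : IsPlanarBM μ B w) (t : ℝ≥0) (ht : t ≠ 0) (ρ : ℝ) :
    μ {ω | ‖B t ω - w‖ ≤ ρ} ≤
      ENNReal.ofReal (√(2 * Real.pi * t))⁻¹ * ENNReal.ofReal (2 * ρ) := by
  have h1 := planarGaussian_norm_le t ht ρ
  have h2 := h.incr 0 t zero_le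
  rw [tsub_zero] at h2
  rw [← h2, Measure.map_apply (h.measurable_incr 0 t)
    (measurableSet_le measurable_norm measurable_const)] at h1
  refine le_trans (measure_mono_ae ?_) h1
  filter_upwards [h.start] with ω h0 h3
  change ‖B t ω - B 0 ω‖ ≤ ρ
  rw [h0]
  exact h3

lemma ae_ne_start (h : IsPlanarBM μ B w) (t : ℝ≥0) (ht : t ≠ 0) : ∀ᵐ ω ∂μ, B t ω ≠ w := by
  have h1 := h.measure_norm_sub_le t ht 0
  simp only [mul_zero, ENNReal.ofReal_zero, nonpos_iff_eq_zero] at h1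
  rw [ae_iff, ← h1]
  congr 1
  ext ω
  simp [sub_eq_zero]

lemma ae_exists_lt_norm (h : IsPlanarBM μ B w) (z : ℂ) (r : ℝ) :
    ∀ᵐ ω ∂μ, ∃ t, r < ‖B t ω - z‖ := by
  rw [ae_iff]
  have h1 : Tendsto (fun n : ℕ => ENNReal.ofReal (√(2 * Real.pi * ((n + 1 : ℕ) : ℝ≥0)))⁻¹ *
      ENNReal.ofReal (2 * (r + ‖w - z‖))) atTop (𝓝 0) := by
    rw [← zero_mul (ENNReal.ofReal (2 * (r + ‖w - z‖)))]
    refine ENNReal.Tendsto.mul_const ?_ (Or.inr ENNReal.ofReal_ne_top)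
    rw [← ENNReal.ofReal_zero]
    refine ENNReal.tendsto_ofReal (tendsto_inv_atTop_zero.comp (Real.tendsto_sqrt_atTop.comp ?_))
    refine Tendsto.const_mul_atTop (by positivity) ?_
    exact (tendsto_natCast_atTop_atTop (R := ℝ)).comp (tendsto_add_atTop_nat 1)
  refine le_antisymm (ge_of_tendsto' h1 fun n => ?_) bot_le
  refine le_trans (measure_mono fun ω hω => ?_) (h.measure_norm_sub_le _ (by simp) _)
  simp only [not_exists, not_lt, Set.mem_ofPred_eq] at hω ⊢
  calc ‖B _ ω - w‖ = ‖(B _ ω - z) - (w - z)‖ := by ring_nf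
    _ ≤ _ := (norm_sub_le _ _).trans (by gcongr; exact hω _)

lemma integrable_cexp [IsProbabilityMeasure μ] (h : IsPlanarBM μ B w) (a z : ℂ) (t : ℝ≥0) :
    Integrable (fun ω => Complex.exp (a * (B t ω - z))) μ := by
  have h1 := integrable_cexp_mul_planarGaussian a (t - 0)
  rw [← h.incr 0 t zero_le, integrable_map_measure (by fun_prop)
    (h.measurable_incr 0 t).aemeasurable] at h1
  refine (h1.const_mul (Complex.exp (a * (w - z)))).congr ?_
  filter_upwards [h.start] with ω h0
  simp only [Function.comp, h0, ← Complex.exp_add]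
  ring_nf

lemma setIntegral_cexp [IsProbabilityMeasure μ] (h : IsPlanarBM μ B w) (a z : ℂ) {s t : ℝ≥0}
    (hst : s ≤ t) {A : Set Ω} (hA : MeasurableSet[h.filtration s] A) :
    ∫ ω in A, Complex.exp (a * (B t ω - z)) ∂μ = ∫ ω in A, Complex.exp (a * (B s ω - z)) ∂μ := by
  have hAm : MeasurableSet A := h.filtration.le s _ hA
  let U : Ω → ℂ := A.indicator fun ω => Complex.exp (a * (B s ω - z))
  let V : Ω → ℂ := fun ω => Complex.exp (a * (B t ω - B s ω))
  have hU : Measurable[h.filtration s] U :=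
    Measurable.indicator (by
      have := h.measurable_filtration s
      exact Complex.measurable_exp.comp ((this.sub measurable_const).const_mul a)) hA
  have hV : Measurable[MeasurableSpace.comap (fun ω => B t ω - B s ω) inferInstance] V :=
    Complex.measurable_exp.comp ((comap_measurable (fun ω => B t ω - B s ω)).const_mul a)
  have hUV : IndepFun U V μ := by
    rw [IndepFun_iff_Indep]
    exact indep_of_indep_of_le_left
      (indep_of_indep_of_le_right (h.indep s t hst).symm hV.comap_le) hU.comap_le
  have hU' : Measurable U := hU.mono (h.filtration.le s) le_rfl
  have hV' : Measurable V := Complex.measurable_exp.comp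
    (((h.meas t).sub (h.meas s)).const_mul a)
  have hV1 : ∫ ω, V ω ∂μ = 1 := by
    rw [← integral_cexp_mul_planarGaussian a (t - s), ← h.incr s t hst, integral_map
      (h.measurable_incr s t).aemeasurable (by fun_prop)]
  have := hUV.integral_fun_mul_eq_mul_integral hU'.aestronglyMeasurable hV'.aestronglyMeasurable
  rw [hV1, mul_one, integral_indicator hAm] at this
  rw [← this, ← integral_indicator hAm]
  congr 1
  ext ω
  by_cases hω : ω ∈ A
  · simp only [U, V, Set.indicator_of_mem hω, ← Complex.exp_add]
    ring_nf
  · simp [U, hω]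

end IsPlanarBM

lemma integral_pow_of_integral_cexp {Ω : Type*} [MeasurableSpace Ω] {μ : Measure Ω}
    [IsProbabilityMeasure μ] {ξ : Ω → ℂ} (hξ : AEStronglyMeasurable ξ μ) {R : ℝ}
    (hR : ∀ᵐ ω ∂μ, ‖ξ ω‖ ≤ R) {b : ℂ}
    (h : ∀ a : ℂ, ∫ ω, Complex.exp (a * ξ ω) ∂μ = Complex.exp (a * b)) (k : ℕ) :
    ∫ ω, ξ ω ^ k ∂μ = b ^ k := by
  suffices H : ∀ k : ℕ, ∀ a : ℂ,
      ∫ ω, ξ ω ^ k * Complex.exp (a * ξ ω) ∂μ = b ^ k * Complex.exp (a * b) by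
    simpa using H k 0
  intro k
  induction k with
  | zero => simpa using h
  | succ k ih =>
    intro a
    have hmeas : ∀ (k : ℕ) (a : ℂ),
        AEStronglyMeasurable (fun ω => ξ ω ^ k * Complex.exp (a * ξ ω)) μ := fun k a =>
      (hξ.pow k).mul (Complex.continuous_exp.comp_aestronglyMeasurable (hξ.const_mul a))
    have hbd : ∀ k : ℕ, ∀ᵐ ω ∂μ, ∀ x ∈ Metric.ball a 1,
        ‖ξ ω ^ k * Complex.exp (x * ξ ω)‖ ≤ R ^ k * Real.exp ((‖a‖ + 1) * R) := by
      intro k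
      filter_upwards [hR] with ω hω x hx
      have hR0 : 0 ≤ R := (norm_nonneg _).trans hω
      have hx' : ‖x‖ ≤ ‖a‖ + 1 := by
        have := norm_le_norm_add_norm_sub a x
        rw [mem_ball_iff_norm] at hx
        rw [norm_sub_rev] at this
        linarith
      rw [norm_mul, norm_pow]
      gcongr
      refine (Complex.norm_exp_le_exp_norm _).trans ?_
      rw [norm_mul]
      gcongr
    have hd := (hasDerivAt_integral_of_dominated_loc_of_deriv_le (μ := μ) (𝕜 := ℂ)
      (F := fun x ω => ξ ω ^ k * Complex.exp (x * ξ ω))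
      (F' := fun x ω => ξ ω ^ (k + 1) * Complex.exp (x * ξ ω)) (x₀ := a)
      (Metric.ball_mem_nhds a one_pos) (Eventually.of_forall fun x => hmeas k x)
      (Integrable.of_bound (hmeas k a) _ ((hbd k).mono fun ω hω =>
        hω a (Metric.mem_ball_self one_pos)))
      (hmeas (k + 1) a) (hbd (k + 1)) (integrable_const _)
      (Eventually.of_forall fun ω x _ => by
        have := (((hasDerivAt_id x).mul_const (ξ ω)).cexp).const_mul (ξ ω ^ k)
        refine this.congr_deriv ?_
        simp
        ring)).2
    simp only [ih] at hd
    have hd2 : HasDerivAt (fun x : ℂ => b ^ k * Complex.exp (x * b))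
        (b ^ (k + 1) * Complex.exp (a * b)) a := by
      refine ((((hasDerivAt_id a).mul_const b).cexp).const_mul (b ^ k)).congr_deriv ?_
      simp
      ring
    exact hd.unique hd2

namespace IsPlanarBM

variable {Ω : Type*} [mΩ : MeasurableSpace Ω] {μ : Measure Ω} {B : ℝ≥0 → Ω → ℂ} {w : ℂ}

lemma integral_re_cexp_exit [IsProbabilityMeasure μ] (h : IsPlanarBM μ B w) {z : ℂ} {r : ℝ}
    (hw : ‖w - z‖ ≤ r) {T : Ω → ℝ≥0} (hT : ∀ᵐ ω ∂μ, IsExitTime (fun t => B t ω) z r (T ω))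
    (a c : ℂ) :
    ∫ ω, (c * Complex.exp (a * (B (T ω) ω - z))).re ∂μ = (c * Complex.exp (a * (w - z))).re := by
  have h_int : ∀ t, Integrable (fun ω => c * Complex.exp (a * (B t ω - z))) μ := fun t =>
    (h.integrable_cexp a z t).const_mul c
  have hb : ∀ᵐ ω ∂μ, ∀ t ≤ T ω,
      |(c * Complex.exp (a * (B t ω - z))).re| ≤ ‖c‖ * Real.exp (‖a‖ * r) := by
    filter_upwards [hT, h.cont, h.start] with ω h1 h2 h3 t ht
    refine (Complex.abs_re_le_norm _).trans ?_
    rw [norm_mul]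
    gcongr
    refine (Complex.norm_exp_le_exp_norm _).trans ?_
    rw [norm_mul]
    gcongr
    exact h1.norm_le h2 (by rwa [h3]) ht
  have key : ∀ N : ℕ, _ := fun N : ℕ =>
    integral_stopped_exit (μ := μ) h.filtration (N := N)
      (Z := fun ω => (c * Complex.exp (a * (B N ω - z))).re)
      (M := fun t ω => (c * Complex.exp (a * (B t ω - z))).re) (h_int N).re
      (fun t ht => by
        refine ae_eq_condExp_of_forall_setIntegral_eq (h.filtration.le t) (h_int N).re
          (fun s _ _ => (h_int t).re.integrableOn) (fun s hs _ => ?_) ?_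
        · have h1 := integral_re (μ := μ.restrict s) (h_int t).integrableOn
          have h2 := integral_re (μ := μ.restrict s) (h_int N).integrableOn
          simp only [RCLike.re_to_complex] at h1 h2
          rw [h1, h2, integral_const_mul, integral_const_mul, h.setIntegral_cexp a z ht hs]
        · have := h.measurable_filtration t
          refine Measurable.aestronglyMeasurable ?_
          exact Complex.measurable_re.comp ((Complex.measurable_exp.comp
            ((this.sub measurable_const).const_mul a)).const_mul c))
      (by
        filter_upwards [h.cont] with ω hω
        fun_prop)
      h.measurable_filtration h.cont hT (hb.mono fun ω hω => hω _ (min_le_left _ _))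
  have hlim : Tendsto (fun N : ℕ => ∫ ω, (c * Complex.exp (a * (B (min (T ω) N) ω - z))).re ∂μ)
      atTop (𝓝 (∫ ω, (c * Complex.exp (a * (B (T ω) ω - z))).re ∂μ)) := by
    refine tendsto_integral_of_dominated_convergence (fun _ => ‖c‖ * Real.exp (‖a‖ * r))
      (fun N => (key N).1) (integrable_const _)
      (fun N => hb.mono fun ω hω => hω _ (min_le_left _ _)) (Eventually.of_forall fun ω => ?_)
    refine tendsto_const_nhds.congr' ?_
    filter_upwards [eventually_ge_atTop ⌈T ω⌉₊] with N hN
    rw [min_eq_left (Nat.ceil_le.1 hN)]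
  have hconst : ∀ N : ℕ, ∫ ω, (c * Complex.exp (a * (B (min (T ω) N) ω - z))).re ∂μ
      = (c * Complex.exp (a * (w - z))).re := by
    intro N
    rw [(key N).2]
    have h1 := integral_re (h_int N)
    simp only [RCLike.re_to_complex] at h1
    have h2 := h.setIntegral_cexp a z (s := 0) (t := N) zero_le MeasurableSet.univ
    rw [Measure.restrict_univ] at h2
    rw [h1, integral_const_mul, h2]
    have h3 : ∫ ω, Complex.exp (a * (B 0 ω - z)) ∂μ = ∫ _ω, Complex.exp (a * (w - z)) ∂μ :=
      integral_congr_ae (h.start.mono fun ω hω => by simp only [hω])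
    rw [h3]
    simp
  simp only [hconst] at hlim
  exact (tendsto_nhds_unique tendsto_const_nhds hlim).symm

/-- The moments of the position at which planar Brownian motion leaves a disc. -/
lemma integral_pow_exit [IsProbabilityMeasure μ] (h : IsPlanarBM μ B w) {z : ℂ} {r : ℝ}
    (hw : ‖w - z‖ ≤ r) {T : Ω → ℝ≥0} (hT : ∀ᵐ ω ∂μ, IsExitTime (fun t => B t ω) z r (T ω))
    (hm : AEStronglyMeasurable (fun ω => B (T ω) ω) μ) (k : ℕ) :
    ∫ ω, (B (T ω) ω - z) ^ k ∂μ = (w - z) ^ k := by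
  have hb : ∀ᵐ ω ∂μ, ‖B (T ω) ω - z‖ ≤ r := by
    filter_upwards [hT, h.cont, h.start] with ω h1 h2 h3
    exact h1.norm_le h2 (by rwa [h3]) le_rfl
  have hm' := hm.sub (aestronglyMeasurable_const (b := z))
  refine integral_pow_of_integral_cexp hm' hb (fun a => ?_) k
  have h_int : Integrable (fun ω => Complex.exp (a * (B (T ω) ω - z))) μ := by
    refine Integrable.of_bound (Complex.continuous_exp.comp_aestronglyMeasurable
      (hm'.const_mul a)) (Real.exp (‖a‖ * r)) (hb.mono fun ω hω => ?_)
    refine (Complex.norm_exp_le_exp_norm _).trans ?_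
    rw [norm_mul]
    gcongr
  have hc : ∀ c : ℂ, (c * ∫ ω, Complex.exp (a * (B (T ω) ω - z)) ∂μ).re
      = (c * Complex.exp (a * (w - z))).re := fun c => by
    rw [← h.integral_re_cexp_exit hw hT a c, ← integral_const_mul]
    exact (integral_re (h_int.const_mul c)).symm
  refine Complex.ext ?_ ?_
  · simpa using hc 1
  · simpa using hc (-Complex.I)

end IsPlanarBM

lemma sum_pow_natAbs_le {q : ℝ} (hq : 0 ≤ q) (hq2 : q ≤ 1 / 2) (S : Finset ℤ) :
    ∑ n ∈ S.erase 0, q ^ n.natAbs ≤ 4 * q := by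
  have hq1 : q < 1 := by linarith
  have h1 : HasSum (fun n : ℤ => q ^ n.natAbs) ((1 - q)⁻¹ + (1 - q)⁻¹ * q) := by
    refine HasSum.of_nat_of_neg_add_one ?_ ?_
    · simpa using hasSum_geometric_of_lt_one hq hq1
    · refine ((hasSum_geometric_of_lt_one hq hq1).mul_right q).congr_fun ?_
      intro n
      rw [Int.natAbs_neg, show ((n : ℤ) + 1).natAbs = n + 1 by omega, pow_succ]
  have h2 := sum_le_hasSum (insert 0 (S.erase 0)) (fun n _ => by positivity) h1
  rw [Finset.sum_insert (by simp)] at h2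
  have h3 : (1 - q)⁻¹ + (1 - q)⁻¹ * q = 1 + 2 * q / (1 - q) := by
    field_simp [show 1 - q ≠ 0 by linarith]
    ring
  have h4 : 2 * q / (1 - q) ≤ 4 * q := by
    rw [div_le_iff₀ (by linarith)]
    nlinarith
  simp only [Int.natAbs_zero, pow_zero] at h2
  linarith

lemma exists_laurent_approx_circle {g : ℂ → ℂ} (hg : Continuous g) {ε : ℝ} (hε : 0 < ε) :
    ∃ (S : Finset ℤ) (c : ℤ → ℂ), ∀ ζ : ℂ, ‖ζ‖ = 1 → ‖g ζ - ∑ n ∈ S, c n * ζ ^ n‖ < ε := by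
  have : Fact (0 < (1 : ℝ)) := ⟨one_pos⟩
  let G : C(AddCircle (1 : ℝ), ℂ) := ⟨fun x => g (AddCircle.toCircle x), by fun_prop⟩
  have hG : G ∈ (Submodule.span ℂ (Set.range <| @fourier (1 : ℝ))).topologicalClosure := by
    rw [span_fourier_closure_eq_top]; trivial
  obtain ⟨p, hp, hGp⟩ := Metric.mem_closure_iff.1 hG ε hε
  obtain ⟨c, rfl⟩ := Finsupp.mem_span_range_iff_exists_finsupp.1 hp
  refine ⟨c.support, c, fun ζ hζ => ?_⟩
  obtain ⟨x, hx⟩ := (AddCircle.homeomorphCircle (one_ne_zero (α := ℝ))).surjective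
    (⟨ζ, by simpa [Submonoid.unitSphere] using hζ⟩ : Circle)
  have hx' : (AddCircle.toCircle x : ℂ) = ζ := by
    rw [AddCircle.homeomorphCircle_apply] at hx
    rw [hx]
  refine lt_of_le_of_lt (le_of_eq_of_le ?_ (ContinuousMap.dist_apply_le_dist x)) hGp
  rw [dist_eq_norm]
  congr 2
  · simp [G, hx']
  · simp [Finsupp.sum, ContinuousMap.sum_apply, ← hx', fourier_apply, AddCircle.toCircle_zsmul]

/-- Two random points of the unit circle have close laws if one is uniform and the other one has
moments close to those of the uniform law. -/
lemma norm_integral_sub_le_of_moments {Ω Ω' : Type} [MeasurableSpace Ω] [MeasurableSpace Ω']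
    {μ : Measure Ω} {ν : Measure Ω'} [IsProbabilityMeasure μ] [IsProbabilityMeasure ν]
    {ξ : Ω → ℂ} {η : Ω' → ℂ} (hξ : AEStronglyMeasurable ξ μ) (hη : AEStronglyMeasurable η ν)
    (hξ1 : ∀ᵐ ω ∂μ, ‖ξ ω‖ = 1) (hη1 : ∀ᵐ ω ∂ν, ‖η ω‖ = 1) {b : ℂ} (hb : ‖b‖ ≤ 1 / 2)
    (hξm : ∀ k : ℕ, ∫ ω, ξ ω ^ k ∂μ = b ^ k) (hηm : ∀ k : ℕ, ∫ ω, η ω ^ k ∂ν = 0 ^ k)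
    {g : ℂ → ℂ} (hg : Continuous g) {D : ℝ} (hD : ∀ x, ‖g x‖ ≤ D) :
    ‖∫ ω, g (ξ ω) ∂μ - ∫ ω, g (η ω) ∂ν‖ ≤ 4 * D * ‖b‖ := by
  have hz : ∀ {Ω : Type} [MeasurableSpace Ω] {μ : Measure Ω} {ξ : Ω → ℂ} {b : ℂ},
      (∀ᵐ ω ∂μ, ‖ξ ω‖ = 1) → (∀ k : ℕ, ∫ ω, ξ ω ^ k ∂μ = b ^ k) →
      ∀ n : ℤ, ‖∫ ω, ξ ω ^ n ∂μ‖ = ‖b‖ ^ n.natAbs := by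
    intro Ω _ μ ξ b h1 hm n
    obtain ⟨k, rfl | rfl⟩ := n.eq_nat_or_neg
    · simp [hm]
    · have : ∫ ω, ξ ω ^ (-(k : ℤ)) ∂μ = ∫ ω, (starRingEnd ℂ) (ξ ω ^ k) ∂μ := by
        refine integral_congr_ae (h1.mono fun ω hω => ?_)
        simp only [zpow_neg, zpow_natCast]
        rw [Complex.inv_eq_conj (by simp [hω])]
      rw [this, integral_conj, hm]
      simp
  have hzi : ∀ {Ω : Type} [MeasurableSpace Ω] {μ : Measure Ω} [IsProbabilityMeasure μ]
      {ξ : Ω → ℂ}, AEStronglyMeasurable ξ μ → (∀ᵐ ω ∂μ, ‖ξ ω‖ = 1) →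
      ∀ n : ℤ, Integrable (fun ω => ξ ω ^ n) μ := by
    intro Ω _ μ _ ξ hξ h1 n
    refine Integrable.of_bound ?_ 1 (h1.mono fun ω hω => by simp [hω])
    exact (hξ.aemeasurable.pow_const n).aestronglyMeasurable
  refine le_of_forall_pos_le_add fun ε hε => ?_
  obtain ⟨S, c, hSc⟩ := exists_laurent_approx_circle hg (ε := ε / 4) (by positivity)
  set p : ℂ → ℂ := fun ζ => ∑ n ∈ S, c n * ζ ^ n with hp
  have hapx : ∀ {Ω : Type} [MeasurableSpace Ω] {μ : Measure Ω} [IsProbabilityMeasure μ]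
      {ξ : Ω → ℂ}, AEStronglyMeasurable ξ μ → (∀ᵐ ω ∂μ, ‖ξ ω‖ = 1) →
      ‖∫ ω, g (ξ ω) ∂μ - ∫ ω, p (ξ ω) ∂μ‖ ≤ ε / 4 := by
    intro Ω _ μ _ ξ hξ h1
    rw [← integral_sub]
    · refine (norm_integral_le_of_norm_le_const (h1.mono fun ω hω => (hSc _ hω).le)).trans ?_
      simp
    · exact Integrable.of_bound (hg.comp_aestronglyMeasurable hξ) D
        (Eventually.of_forall fun ω => hD _)
    · exact integrable_finsetSum _ fun n _ => (hzi hξ h1 n).const_mul _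
  have h_int : ∀ {Ω : Type} [MeasurableSpace Ω] {μ : Measure Ω} [IsProbabilityMeasure μ]
      {ξ : Ω → ℂ}, AEStronglyMeasurable ξ μ → (∀ᵐ ω ∂μ, ‖ξ ω‖ = 1) →
      ∫ ω, p (ξ ω) ∂μ = ∑ n ∈ S, c n * ∫ ω, ξ ω ^ n ∂μ := by
    intro Ω _ μ _ ξ hξ h1
    rw [integral_finsetSum _ fun n _ => (hzi hξ h1 n).const_mul _]
    simp only [integral_const_mul]
  have hη0 : ∀ n : ℤ, n ≠ 0 → ∫ ω, η ω ^ n ∂ν = 0 := fun n hn => by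
    rw [← norm_eq_zero, hz hη1 hηm n]
    simp [hn]
  have hc : ∀ m ∈ S, ‖c m‖ ≤ D + ε / 4 := by
    intro m hm
    have h1 : ∫ ω, p (η ω) * η ω ^ (-m) ∂ν = c m := by
      have h2 : ∫ ω, p (η ω) * η ω ^ (-m) ∂ν = ∫ ω, ∑ n ∈ S, c n * η ω ^ (n - m) ∂ν := by
        refine integral_congr_ae (hη1.mono fun ω hω => ?_)
        have h0 : η ω ≠ 0 := by
          rw [← norm_ne_zero_iff, hω]; exact one_ne_zero
        simp only [hp, Finset.sum_mul]
        refine Finset.sum_congr rfl fun n _ => ?_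
        rw [mul_assoc, ← zpow_add₀ h0, sub_eq_add_neg]
      rw [h2, integral_finsetSum _ fun n _ => (hzi hη hη1 _).const_mul _,
        Finset.sum_eq_single m]
      · simp
      · intro n _ hnm
        rw [integral_const_mul, hη0 _ (sub_ne_zero.2 hnm), mul_zero]
      · exact fun h => absurd hm h
    rw [← h1]
    refine (norm_integral_le_of_norm_le_const (C := D + ε / 4) (hη1.mono fun ω hω => ?_)).trans
      (by simp)
    rw [norm_mul, norm_zpow, hω, one_zpow, mul_one]
    have h3 := norm_le_norm_add_norm_sub (g (η ω)) (p (η ω))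
    linarith [hD (η ω), hSc _ hω]
  have hmain : ‖∫ ω, p (ξ ω) ∂μ - ∫ ω, p (η ω) ∂ν‖ ≤ (D + ε / 4) * (4 * ‖b‖) := by
    rw [h_int hξ hξ1, h_int hη hη1, ← Finset.sum_sub_distrib]
    have h1 : ∑ n ∈ S, (c n * ∫ ω, ξ ω ^ n ∂μ - c n * ∫ ω, η ω ^ n ∂ν)
        = ∑ n ∈ S.erase 0, c n * ∫ ω, ξ ω ^ n ∂μ := by
      rw [← Finset.sum_erase S (a := 0) (by simp)]
      refine Finset.sum_congr rfl fun n hn => ?_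
      rw [hη0 n (Finset.ne_of_mem_erase hn), mul_zero, sub_zero]
    rw [h1]
    have hD0 : 0 ≤ D := (norm_nonneg _).trans (hD 0)
    calc _ ≤ ∑ n ∈ S.erase 0, (D + ε / 4) * ‖b‖ ^ n.natAbs := by
          refine norm_sum_le_of_le _ fun n hn => ?_
          rw [norm_mul, hz hξ1 hξm]
          gcongr
          exact hc n (Finset.mem_of_mem_erase hn)
      _ = (D + ε / 4) * ∑ n ∈ S.erase 0, ‖b‖ ^ n.natAbs := by rw [Finset.mul_sum]
      _ ≤ _ := by
          gcongr
          exact sum_pow_natAbs_le (norm_nonneg b) hb S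
  have h1 := hapx hξ hξ1
  have h2 := hapx hη hη1
  rw [norm_sub_rev] at h2
  have h3 : ∫ ω, g (ξ ω) ∂μ - ∫ ω, g (η ω) ∂ν = (∫ ω, g (ξ ω) ∂μ - ∫ ω, p (ξ ω) ∂μ)
      + (∫ ω, p (ξ ω) ∂μ - ∫ ω, p (η ω) ∂ν) + (∫ ω, p (η ω) ∂ν - ∫ ω, g (η ω) ∂ν) := by ring
  rw [h3]
  refine (norm_add₃_le).trans ?_
  nlinarith [norm_nonneg b]

lemma measurable_path_apply (t : ℝ≥0) : Measurable fun X : PathSp => X t :=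
  (ContinuousEvalConst.continuous_eval_const t).measurable

lemma measurable_path_eval : Measurable fun p : PathSp × ℝ≥0 => p.1 p.2 :=
  (continuous_eval (F := PathSp)).measurable

lemma pastAlg_le (s : ℝ≥0) : pastAlg s ≤ (inferInstance : MeasurableSpace PathSp) :=
  iSup₂_le fun u _ => (measurable_path_apply u).comap_le

/-- The natural filtration of the coordinate process. -/
def pastFiltration : Filtration ℝ≥0 (inferInstance : MeasurableSpace PathSp) where
  seq := pastAlg
  mono' _ _ hst := biSup_mono fun _ hu => le_trans hu hst
  le' := pastAlg_le

lemma measurable_pastAlg_apply {u s : ℝ≥0} (h : u ≤ s) :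
    Measurable[pastAlg s] fun X : PathSp => X u :=
  Measurable.of_comap_le (le_iSup₂_of_le u h le_rfl)

/-- The paths which leave the closed ball of radius `r` about `z` before time `a`. -/
def exitBefore (z : ℂ) (r : ℝ) (a : ℝ≥0) : Set PathSp := {X | ∃ t < a, r < ‖X t - z‖}

lemma isOpen_exists_lt_norm (s : Set ℝ≥0) (z : ℂ) (r : ℝ) :
    IsOpen {X : PathSp | ∃ t ∈ s, r < ‖X t - z‖} := by
  have h : {X : PathSp | ∃ t ∈ s, r < ‖X t - z‖} = ⋃ t ∈ s, {X : PathSp | r < ‖X t - z‖} := by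
    ext X; simp
  rw [h]
  refine isOpen_biUnion fun t _ => isOpen_lt continuous_const ?_
  exact ((ContinuousEvalConst.continuous_eval_const t).sub continuous_const).norm

lemma isOpen_exitBefore (z : ℂ) (r : ℝ) (a : ℝ≥0) : IsOpen (exitBefore z r a) :=
  isOpen_exists_lt_norm (Set.Iio a) z r

/-- The exit time from the closed ball of radius `r` about `z`. -/
def exitTime (z : ℂ) (r : ℝ) (X : PathSp) : ℝ≥0 := sInf {t | r < ‖X t - z‖}

lemma isExitTime_exitTime {z : ℂ} {r : ℝ} {X : PathSp} (h : ∃ t, r < ‖X t - z‖) :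
    IsExitTime X z r (exitTime z r X) where
  before t ht := not_lt.1 fun h1 => absurd (csInf_le' (a := t) h1) (not_le.2 ht)
  after b hb := by
    obtain ⟨t, ht, htb⟩ := exists_lt_of_csInf_lt h hb
    exact ⟨t, htb, ht⟩

lemma exitTime_lt {z : ℂ} {r : ℝ} {a : ℝ≥0} {X : PathSp} (h : X ∈ exitBefore z r a) :
    exitTime z r X < a := by
  obtain ⟨t, hta, ht⟩ := h
  exact lt_of_le_of_lt (csInf_le' ht) hta

lemma measurable_exitTime (z : ℂ) (r : ℝ) : Measurable (exitTime z r) := by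
  refine measurable_of_Iio fun a => ?_
  have h : exitTime z r ⁻¹' Set.Iio a =
      exitBefore z r a ∪ {X | 0 < a ∧ X ∉ {X : PathSp | ∃ t ∈ Set.univ, r < ‖X t - z‖}} := by
    ext X
    simp only [Set.mem_preimage, Set.mem_Iio, Set.mem_union, Set.mem_ofPred_eq]
    constructor
    · intro hX
      by_cases he : ∃ t ∈ Set.univ, r < ‖X t - z‖
      · obtain ⟨t, ht, hta⟩ := exists_lt_of_csInf_lt
          (s := {t | r < ‖X t - z‖}) (let ⟨t, _, ht⟩ := he; ⟨t, ht⟩) hX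
        exact Or.inl ⟨t, hta, ht⟩
      · exact Or.inr ⟨pos_of_gt hX, he⟩
    · rintro (hX | ⟨ha, hX⟩)
      · exact exitTime_lt hX
      · have h0 : {t | r < ‖X t - z‖} = ∅ := by
          ext t
          simpa using fun ht => hX ⟨t, trivial, ht⟩
        rwa [exitTime, h0, NNReal.sInf_empty]
  rw [h]
  refine (isOpen_exitBefore z r a).measurableSet.union (MeasurableSet.inter ?_ ?_)
  · exact MeasurableSet.const _
  · exact (isOpen_exists_lt_norm Set.univ z r).measurableSet.compl

lemma measurable_exitPoint (z : ℂ) (r : ℝ) :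
    Measurable fun X : PathSp => X (exitTime z r X) :=
  measurable_path_eval.comp (measurable_id.prodMk (measurable_exitTime z r))

namespace Realizes

variable {Ω : Type} [MeasurableSpace Ω] {μ : Measure Ω} {B : ℝ≥0 → Ω → ℂ}
  {τ : ℝ≥0 → Ω → ℝ≥0} {F : Ω → PathSp} {w : ℂ} {ν : Measure PathSp}

lemma ae_range (h : Realizes μ B τ F w ν) :
    ∀ᵐ ω ∂μ, ∀ a s : ℝ≥0, s ≤ τ a ω → ∃ u ≤ a, τ u ω = s := by
  filter_upwards [h.2.2.1] with ω hω a s hs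
  have h1 := intermediate_value_Icc (zero_le (a := a)) hω.2.2.1.continuousOn
  obtain ⟨u, hu, hus⟩ := h1 ⟨by simp [hω.1], hs⟩
  exact ⟨u, hu.2, hus⟩

lemma ae_exists_lt_norm (h : Realizes μ B τ F w ν) (z : ℂ) (r : ℝ) :
    ∀ᵐ X ∂ν, ∃ t, r < ‖X t - z‖ := by
  have hm : MeasurableSet {X : PathSp | ∃ t, r < ‖X t - z‖} := by
    simpa using (isOpen_exists_lt_norm Set.univ z r).measurableSet
  rw [← h.2.2.2.2.2, ae_map_iff h.2.2.2.1.aemeasurable hm]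
  filter_upwards [h.ae_range, h.2.2.1, h.2.2.2.2.1, h.2.1.ae_exists_lt_norm z r]
    with ω h1 h2 h3 ⟨s, hs⟩
  obtain ⟨a, ha⟩ := (h2.2.2.2.eventually_ge_atTop s).exists
  obtain ⟨u, -, hu⟩ := h1 a s ha
  exact ⟨u, by rwa [h3, hu]⟩

lemma ae_exists_ne (h : Realizes μ B τ F w ν) {a : ℝ≥0} (ha : 0 < a) :
    ∀ᵐ X ∂ν, ∃ t < a, 0 < ‖X t - w‖ := by
  have hm : MeasurableSet {X : PathSp | ∃ t < a, 0 < ‖X t - w‖} :=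
    (isOpen_exists_lt_norm (Set.Iio a) w 0).measurableSet
  rw [← h.2.2.2.2.2, ae_map_iff h.2.2.2.1.aemeasurable hm]
  have hB : ∀ᵐ ω ∂μ, ∀ n : ℕ, B (1 / ((n : ℝ≥0) + 1)) ω ≠ w :=
    ae_all_iff.2 fun n => h.2.1.ae_ne_start _ (by positivity)
  filter_upwards [h.ae_range, h.2.2.1, h.2.2.2.2.1, hB] with ω h1 h2 h3 h4
  have hpos : 0 < τ (a / 2) ω := by
    rw [← h2.1]
    exact h2.2.1 (by positivity)
  obtain ⟨n, hn⟩ := exists_nat_one_div_lt hpos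
  obtain ⟨u, hua, hu⟩ := h1 _ _ hn.le
  refine ⟨u, lt_of_le_of_lt hua (NNReal.half_lt_self ha.ne'), ?_⟩
  rw [h3, hu, norm_pos_iff, sub_ne_zero]
  exact h4 n

lemma integral_pow_exit (h : Realizes μ B τ F w ν) {z : ℂ} {r : ℝ} (hw : ‖w - z‖ ≤ r) (k : ℕ) :
    ∫ X, (X (exitTime z r X) - z) ^ k ∂ν = (w - z) ^ k := by
  have := h.1
  have hF := h.2.2.2.1
  have hex := h.ae_exists_lt_norm z r
  rw [← h.2.2.2.2.2] at hex ⊢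
  have hB : (fun ω => B (τ (exitTime z r (F ω)) ω) ω) =ᵐ[μ] fun ω => F ω (exitTime z r (F ω)) := by
    filter_upwards [h.2.2.2.2.1] with ω h3
    rw [h3]
  rw [integral_map hF.aemeasurable
    (((measurable_exitPoint z r).sub_const z).pow_const k).aestronglyMeasurable]
  rw [← h.2.1.integral_pow_exit (T := fun ω => τ (exitTime z r (F ω)) ω) hw ?_ ?_ k]
  · exact integral_congr_ae (hB.mono fun ω hω => by simp only [hω])
  · filter_upwards [h.ae_range, h.2.2.1, h.2.2.2.2.1, ae_of_ae_map hF.aemeasurable hex]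
      with ω h1 h2 h3 h4
    have hT := isExitTime_exitTime h4
    refine ⟨fun t ht => ?_, fun b hb => ?_⟩
    · obtain ⟨u, -, rfl⟩ := h1 _ t ht.le
      rw [← h3]
      exact hT.before u (h2.2.1.lt_iff_lt.1 ht)
    · have hev : ∀ᶠ a in 𝓝 (exitTime z r (F ω)), τ a ω < b :=
        h2.2.2.1.continuousAt.eventually (gt_mem_nhds hb)
      obtain ⟨a, ha, hab⟩ := exists_Ico_subset_of_mem_nhds hev ⟨exitTime z r (F ω) + 1, by simp⟩
      obtain ⟨u, hua, hu⟩ := hT.after a ha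
      refine ⟨τ u ω, ?_, by rwa [← h3]⟩
      rcases lt_or_ge u (exitTime z r (F ω)) with h5 | h5
      · exact (h2.2.1 h5).trans hb
      · exact hab ⟨h5, hua⟩
  · refine (AEMeasurable.congr ?_ hB.symm).aestronglyMeasurable
    exact ((measurable_exitPoint z r).comp hF).aemeasurable

end Realizes

lemma integrableOn_exp_neg_mul {l : ℝ} (hl : 0 < l) :
    IntegrableOn (fun t : ℝ => Real.exp (-(l * t))) (Set.Ioi 0) := by
  simpa only [neg_mul] using integrableOn_exp_mul_Ioi (neg_lt_zero.2 hl) 0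

lemma integral_exp_neg_mul {l : ℝ} (hl : 0 < l) :
    ∫ t in Set.Ioi (0 : ℝ), Real.exp (-(l * t)) = 1 / l := by
  simpa only [neg_mul, mul_zero, neg_zero, Real.exp_zero, neg_div_neg_eq] using
    integral_exp_mul_Ioi (neg_lt_zero.2 hl) 0

/-- The integral of the discounted value of `f` along a path. -/
def discountedIntegral (l : ℝ) (f : ℂ → ℝ) (X : PathSp) : ℝ :=
  ∫ t in Set.Ioi (0 : ℝ), Real.exp (-(l * t)) * f (X t.toNNReal)

section Resolvent

variable {P : ℂ → ProbabilityMeasure PathSp} {l : ℝ} {f : ℂ → ℝ} {C : ℝ}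

lemma measurable_discounted (hf : Measurable f) :
    Measurable fun p : PathSp × ℝ => Real.exp (-(l * p.2)) * f (p.1 p.2.toNNReal) := by
  have h : Measurable fun p : PathSp × ℝ => p.1 p.2.toNNReal :=
    measurable_path_eval.comp (measurable_fst.prodMk (measurable_real_toNNReal.comp measurable_snd))
  have h2 := hf.comp h
  simp only [Function.comp_def] at h2
  fun_prop

lemma abs_discounted_le (hC : ∀ x, |f x| ≤ C) (t : ℝ) (x : ℂ) :
    ‖Real.exp (-(l * t)) * f x‖ ≤ Real.exp (-(l * t)) * C := by
  rw [norm_mul, Real.norm_eq_abs, Real.norm_eq_abs, Real.abs_exp]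
  gcongr
  exact hC x

lemma integrableOn_discounted (hl : 0 < l) (hf : Measurable f) (hC : ∀ x, |f x| ≤ C)
    (X : PathSp) :
    IntegrableOn (fun t : ℝ => Real.exp (-(l * t)) * f (X t.toNNReal)) (Set.Ioi 0) := by
  refine ((integrableOn_exp_neg_mul hl).mul_const C).mono' ?_
    (Eventually.of_forall fun t => abs_discounted_le hC t _)
  exact ((measurable_discounted hf).comp measurable_prodMk_left).aestronglyMeasurable

lemma measurable_discountedIntegral (hf : Measurable f) :
    Measurable (discountedIntegral l f) :=
  (StronglyMeasurable.integral_prod_right' (ν := volume.restrict (Set.Ioi (0 : ℝ)))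
    (measurable_discounted hf).stronglyMeasurable).measurable

lemma abs_integral_discounted_le (hl : 0 < l) {φ : ℝ → ℝ} (hφ : ∀ t, |φ t| ≤ C) :
    |∫ t in Set.Ioi (0 : ℝ), Real.exp (-(l * t)) * φ t| ≤ C / l := by
  refine (norm_integral_le_of_norm_le (μ := volume.restrict (Set.Ioi 0))
    (f := fun t => Real.exp (-(l * t)) * φ t) (g := fun t => Real.exp (-(l * t)) * C)
    ((integrableOn_exp_neg_mul hl).mul_const C) (Eventually.of_forall fun t => ?_)).trans
    (le_of_eq ?_)
  · rw [norm_mul, Real.norm_eq_abs, Real.norm_eq_abs, Real.abs_exp]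
    gcongr
    exact hφ t
  · rw [integral_mul_const, integral_exp_neg_mul hl]
    ring

lemma abs_discountedIntegral_le (hl : 0 < l) (hC : ∀ x, |f x| ≤ C) (X : PathSp) :
    |discountedIntegral l f X| ≤ C / l :=
  abs_integral_discounted_le hl fun _ => hC _

lemma abs_integral_le_of_abs_le {Ω : Type*} [MeasurableSpace Ω] {μ : Measure Ω}
    [IsProbabilityMeasure μ] {φ : Ω → ℝ} (hφ : ∀ ω, |φ ω| ≤ C) : |∫ ω, φ ω ∂μ| ≤ C := by
  simpa using norm_integral_le_of_norm_le_const (μ := μ) (f := φ) (Eventually.of_forall hφ)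

lemma abs_resolventOp_le (hl : 0 < l) (hC : ∀ x, |f x| ≤ C) (z : ℂ) :
    |resolventOp P l f z| ≤ C / l :=
  abs_integral_discounted_le hl fun _ => abs_integral_le_of_abs_le fun _ => hC _

lemma integrable_discounted_prod (hl : 0 < l) (hf : Measurable f) (hC : ∀ x, |f x| ≤ C)
    (ν : Measure PathSp) [IsProbabilityMeasure ν] :
    Integrable (fun p : PathSp × ℝ => Real.exp (-(l * p.2)) * f (p.1 p.2.toNNReal))
      (ν.prod (volume.restrict (Set.Ioi (0 : ℝ)))) := by
  refine Integrable.mono' (g := fun p : PathSp × ℝ => Real.exp (-(l * p.2)) * C) ?_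
    (measurable_discounted hf).aestronglyMeasurable
    (Eventually.of_forall fun p => abs_discounted_le hC _ _)
  exact ((integrableOn_exp_neg_mul hl).mul_const C).comp_snd ν

lemma integral_discountedIntegral (hl : 0 < l) (hf : Measurable f) (hC : ∀ x, |f x| ≤ C)
    (z : ℂ) : ∫ X, discountedIntegral l f X ∂(P z : Measure PathSp) = resolventOp P l f z := by
  simp only [discountedIntegral, resolventOp]
  rw [integral_integral_swap (integrable_discounted_prod hl hf hC _)]
  simp only [integral_const_mul]

lemma continuous_resolventOp_of_continuous (hP : Continuous P) (hl : 0 < l) (hf : Continuous f)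
    (hC : ∀ x, |f x| ≤ C) : Continuous (resolventOp P l f) := by
  refine continuous_of_dominated (bound := fun t => Real.exp (-(l * t)) * C) (fun z => ?_)
    (fun z => Eventually.of_forall fun t => ?_) ((integrableOn_exp_neg_mul hl).mul_const C)
    (Eventually.of_forall fun t => ?_)
  · simp only [← integral_const_mul]
    refine (StronglyMeasurable.integral_prod_left' (μ := (P z : Measure PathSp))
      (measurable_discounted hf.measurable).stronglyMeasurable).aestronglyMeasurable
  · rw [norm_mul, Real.norm_eq_abs, Real.norm_eq_abs, Real.abs_exp]
    gcongr
    exact abs_integral_le_of_abs_le fun _ => hC _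
  · let φ : BoundedContinuousFunction PathSp ℝ := BoundedContinuousFunction.ofNormedAddCommGroup
      (fun X => f (X t.toNNReal))
      (hf.comp (ContinuousEvalConst.continuous_eval_const t.toNNReal)) C fun X => hC _
    exact continuous_const.mul
      ((ProbabilityMeasure.continuous_integral_boundedContinuousFunction φ).comp hP)

lemma measurable_pathShift (s : ℝ≥0) : Measurable (pathShift s) :=
  (ContinuousMap.continuous_precomp _).measurable

lemma discountedIntegral_eq_add (hl : 0 < l) (hf : Measurable f) (hC : ∀ x, |f x| ≤ C)
    (t : ℝ≥0) (X : PathSp) : discountedIntegral l f X =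
      (∫ s in (0 : ℝ)..t, Real.exp (-(l * s)) * f (X s.toNNReal)) +
        Real.exp (-(l * t)) * discountedIntegral l f (pathShift t X) := by
  have hi := integrableOn_discounted hl hf hC X
  rw [discountedIntegral, ← intervalIntegral.integral_interval_add_Ioi hi
    (hi.mono_set (Set.Ioi_subset_Ioi t.coe_nonneg)), discountedIntegral, ← integral_const_mul]
  congr 1
  have h0 := (measurePreserving_add_left volume (t : ℝ)).setIntegral_preimage_emb
    (measurableEmbedding_addLeft _) (fun s => Real.exp (-(l * s)) * f (X s.toNNReal)) (Set.Ioi t)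
  rw [Set.preimage_const_add_Ioi, sub_self] at h0
  rw [← h0]
  refine setIntegral_congr_fun measurableSet_Ioi fun s hs => ?_
  have h1 : ((t : ℝ) + s).toNNReal = t + s.toNNReal := by
    rw [Real.toNNReal_add t.coe_nonneg (le_of_lt hs), Real.toNNReal_coe]
  simp only [h1, pathShift, ContinuousMap.comp_apply, ContinuousMap.coe_mk, ← mul_assoc,
    ← Real.exp_add]
  ring_nf

/-- The martingale closed by the discounted integral of `f`. -/
def resolventMart (P : ℂ → ProbabilityMeasure PathSp) (l : ℝ) (f : ℂ → ℝ) (t : ℝ≥0)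
    (X : PathSp) : ℝ :=
  (∫ s in (0 : ℝ)..t, Real.exp (-(l * s)) * f (X s.toNNReal)) +
    Real.exp (-(l * t)) * resolventOp P l f (X t)

lemma abs_resolventMart_sub_le (hl : 0 < l) (hC : ∀ x, |f x| ≤ C) (t : ℝ≥0) (X : PathSp) :
    |resolventMart P l f t X - resolventOp P l f (X t)| ≤
      2 * (C / l) * (1 - Real.exp (-(l * t))) := by
  have h1 : |∫ s in (0 : ℝ)..t, Real.exp (-(l * s)) * f (X s.toNNReal)| ≤
      C / l * (1 - Real.exp (-(l * t))) := by
    have h2 : ∫ s in (0 : ℝ)..t, Real.exp (-(l * s)) * C = C / l * (1 - Real.exp (-(l * t))) := by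
      rw [intervalIntegral.integral_mul_const]
      have : ∫ s in (0 : ℝ)..t, Real.exp (-(l * s)) =
          ∫ s in (0 : ℝ)..t, Real.exp ((-l) * s) := by simp
      rw [this, intervalIntegral.integral_comp_mul_left (fun x => Real.exp x) (neg_ne_zero.2 hl.ne'),
        integral_exp]
      simp only [mul_zero, Real.exp_zero, smul_eq_mul, neg_mul]
      field_simp
      ring
    rw [← h2]
    exact intervalIntegral.norm_integral_le_of_norm_le t.coe_nonneg
      (Eventually.of_forall fun s _ => abs_discounted_le hC s _)
      (Continuous.intervalIntegrable (by fun_prop) _ _)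
  have h2 := abs_resolventOp_le (P := P) hl hC (X t)
  have h3 : 0 ≤ 1 - Real.exp (-(l * t)) := by
    have : Real.exp (-(l * t)) ≤ 1 := Real.exp_le_one_iff.2 (by simp; positivity)
    linarith
  have h4 : resolventMart P l f t X - resolventOp P l f (X t) =
      (∫ s in (0 : ℝ)..t, Real.exp (-(l * s)) * f (X s.toNNReal)) -
        resolventOp P l f (X t) * (1 - Real.exp (-(l * t))) := by
    rw [resolventMart]; ring
  rw [h4]
  refine (abs_sub _ _).trans ?_
  rw [abs_mul, abs_of_nonneg h3]
  nlinarith [mul_le_mul_of_nonneg_right h2 h3]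

lemma measurable_resolventMart (hf : Measurable f) (hg : Measurable (resolventOp P l f))
    (t : ℝ≥0) : Measurable[pastAlg t] (resolventMart P l f t) := by
  refine Measurable.add (m := pastAlg t) ?_
    ((hg.comp (measurable_pastAlg_apply le_rfl)).const_mul _)
  have h1 : (fun X : PathSp => ∫ s in (0 : ℝ)..t, Real.exp (-(l * s)) * f (X s.toNNReal)) =
      fun X : PathSp => ∫ s in Set.Ioc (0 : ℝ) t,
        Real.exp (-(l * s)) * f (X (min s.toNNReal t)) := by
    ext X
    rw [intervalIntegral.integral_of_le t.coe_nonneg]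
    refine setIntegral_congr_fun measurableSet_Ioc fun s hs => ?_
    have : s.toNNReal ≤ t := Real.toNNReal_le_iff_le_coe.2 hs.2
    simp only [min_eq_left this]
  have h2 : @Measurable _ _ ((inferInstance : MeasurableSpace ℝ).prod (pastAlg t)) _
      (Function.uncurry fun (s : ℝ) (X : PathSp) => X (min s.toNNReal t)) := by
    let _ := pastAlg t
    refine measurable_uncurry_of_continuous_of_measurable (m := pastAlg t) (fun X => ?_)
      fun s => measurable_pastAlg_apply (min_le_right _ _)
    exact X.continuous.comp (continuous_real_toNNReal.min continuous_const)
  have h3 : @Measurable _ _ ((inferInstance : MeasurableSpace ℝ).prod (pastAlg t)) _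
      (Function.uncurry fun (s : ℝ) (X : PathSp) =>
        Real.exp (-(l * s)) * f (X (min s.toNNReal t))) := by
    let _ := pastAlg t
    have h4 : Measurable fun p : ℝ × PathSp => Real.exp (-(l * p.1)) := by fun_prop
    exact h4.mul (hf.comp h2)
  rw [h1]
  exact (@StronglyMeasurable.integral_prod_left _ _ _ _ (pastAlg t)
    (volume.restrict (Set.Ioc (0 : ℝ) t)) _ _ _ _ h3.stronglyMeasurable).measurable

lemma continuous_resolventMart (hf : Continuous f) (hg : Continuous (resolventOp P l f))
    (X : PathSp) : Continuous fun t => resolventMart P l f t X := by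
  have h1 : Continuous fun s : ℝ => Real.exp (-(l * s)) * f (X s.toNNReal) := by fun_prop
  have h2 : Continuous fun b : ℝ => ∫ s in (0 : ℝ)..b, Real.exp (-(l * s)) * f (X s.toNNReal) :=
    intervalIntegral.continuous_primitive (fun a b => h1.intervalIntegrable a b) 0
  unfold resolventMart
  fun_prop

lemma resolventMart_ae_eq_condExp (hP : IsMarkovian P) (hl : 0 < l) (hf : Continuous f)
    (hC : ∀ x, |f x| ≤ C) (hg : Continuous (resolventOp P l f)) (w : ℂ) (t : ℝ≥0) :
    resolventMart P l f t =ᵐ[(P w : Measure PathSp)]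
      (P w : Measure PathSp)[discountedIntegral l f | pastFiltration t] := by
  have hfm := hf.measurable
  have hGm := measurable_discountedIntegral (l := l) hfm
  have hmart := measurable_resolventMart hfm hg.measurable t
  have hb : ∀ {φ : PathSp → ℝ} {K : ℝ}, Measurable φ → (∀ X, |φ X| ≤ K) →
      Integrable φ (P w : Measure PathSp) := fun h1 h2 =>
    Integrable.of_bound h1.aestronglyMeasurable _ (Eventually.of_forall h2)
  have hGi := hb hGm (abs_discountedIntegral_le hl hC)
  have hGs := hb (hGm.comp (measurable_pathShift t)) fun X => abs_discountedIntegral_le hl hC _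
  have hRi := hb (hg.measurable.comp (measurable_path_apply t)) fun X =>
    abs_resolventOp_le hl hC _
  have hIi : Integrable (fun X : PathSp => ∫ s in (0 : ℝ)..t, Real.exp (-(l * s)) *
      f (X s.toNNReal)) (P w : Measure PathSp) := by
    refine (hGi.sub (hGs.const_mul (Real.exp (-(l * t))))).congr (Eventually.of_forall fun X => ?_)
    simp only [Pi.sub_apply, discountedIntegral_eq_add hl hfm hC t X, Function.comp_apply]
    ring
  have hMi : Integrable (resolventMart P l f t) (P w : Measure PathSp) :=
    hIi.add (hRi.const_mul _)
  refine ae_eq_condExp_of_forall_setIntegral_eq (pastFiltration.le t) hGi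
    (fun A _ _ => hMi.integrableOn) (fun A hA _ => ?_) hmart.stronglyMeasurable.aestronglyMeasurable
  have h1 : ∫ X in A, discountedIntegral l f X ∂(P w : Measure PathSp) =
      ∫ X in A, ((∫ s in (0 : ℝ)..t, Real.exp (-(l * s)) * f (X s.toNNReal)) +
        Real.exp (-(l * t)) * discountedIntegral l f (pathShift t X)) ∂(P w : Measure PathSp) := by
    simp only [← discountedIntegral_eq_add hl hfm hC]
  have h2 := hP w t A hA _ hGm ⟨_, abs_discountedIntegral_le hl hC⟩
  simp only [integral_discountedIntegral hl hfm hC] at h2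
  have h3 : Integrable (fun X => Real.exp (-(l * t)) * discountedIntegral l f (pathShift t X))
      (P w : Measure PathSp) := hGs.const_mul _
  rw [h1, integral_add hIi.integrableOn h3.integrableOn, integral_const_mul, h2,
    ← integral_const_mul]
  exact integral_add hIi.integrableOn (hRi.const_mul _).integrableOn

end Resolvent

section ExitLaw

variable {P : ℂ → ProbabilityMeasure PathSp} {l C : ℝ} {f : ℂ → ℝ}

lemma DefinesMTCBM.ae_isExitTime (hP : DefinesMTCBM P) (w z : ℂ) (r : ℝ) :
    ∀ᵐ X : PathSp ∂(P w : Measure PathSp), IsExitTime X z r (exitTime z r X) := by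
  obtain ⟨Ω, _, μ, B, τ, F, h⟩ := hP.2.2 w
  exact (h.ae_exists_lt_norm z r).mono fun X hX => isExitTime_exitTime hX

lemma DefinesMTCBM.ae_norm_exit (hP : DefinesMTCBM P) {w z : ℂ} {r : ℝ} (hw : ‖w - z‖ ≤ r) :
    ∀ᵐ X : PathSp ∂(P w : Measure PathSp), ‖X (exitTime z r X) - z‖ = r := by
  have h0 : ∀ᵐ X : PathSp ∂(P w : Measure PathSp), X 0 = w :=
    (prob_compl_eq_zero_iff (measurable_path_apply 0 (measurableSet_singleton w))).2 (hP.1 w)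
  filter_upwards [hP.ae_isExitTime w z r, h0] with X h1 h2
  exact h1.norm_eq X.continuous (by rwa [h2])

lemma DefinesMTCBM.integral_pow_exit (hP : DefinesMTCBM P) {w z : ℂ} {r : ℝ} (hw : ‖w - z‖ ≤ r)
    (k : ℕ) :
    ∫ X, (X (exitTime z r X) - z) ^ k ∂(P w : Measure PathSp) = (w - z) ^ k := by
  obtain ⟨Ω, _, μ, B, τ, F, h⟩ := hP.2.2 w
  exact h.integral_pow_exit hw k

lemma abs_integral_exit_sub_le (hP : DefinesMTCBM P) {w z : ℂ} {r : ℝ} (hr : 0 < r)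
    (hw : ‖w - z‖ / r ≤ 1 / 2) {g : ℂ → ℝ} (hg : Continuous g) {D : ℝ} (hD : ∀ x, |g x| ≤ D) :
    |∫ X, g (X (exitTime z r X)) ∂(P w : Measure PathSp) -
      ∫ X, g (X (exitTime z r X)) ∂(P z : Measure PathSp)| ≤ 4 * D * (‖w - z‖ / r) := by
  have hr' : (r : ℂ) ≠ 0 := by exact_mod_cast hr.ne'
  set ξ : PathSp → ℂ := fun X => (X (exitTime z r X) - z) / r with hξ
  have hξm : Measurable ξ := ((measurable_exitPoint z r).sub_const z).div_const _
  have hnorm : ∀ {w : ℂ}, ‖w - z‖ ≤ r → ∀ᵐ X ∂(P w : Measure PathSp), ‖ξ X‖ = 1 := by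
    intro w hw
    filter_upwards [hP.ae_norm_exit hw] with X hX
    simp [hξ, hX, abs_of_pos hr, hr.ne']
  have hmom : ∀ {w : ℂ}, ‖w - z‖ ≤ r → ∀ k : ℕ,
      ∫ X, ξ X ^ k ∂(P w : Measure PathSp) = ((w - z) / r) ^ k := by
    intro w hw k
    simp only [hξ, div_pow]
    rw [integral_div, hP.integral_pow_exit hw]
  have hb : ‖(w - z) / r‖ = ‖w - z‖ / r := by simp [abs_of_pos hr]
  have hwr : ‖w - z‖ ≤ r := by
    have := (div_le_iff₀ hr).1 hw
    linarith
  have hzr : ‖z - z‖ ≤ r := by simpa using hr.le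
  have h := norm_integral_sub_le_of_moments (μ := (P w : Measure PathSp))
    (ν := (P z : Measure PathSp)) hξm.aestronglyMeasurable hξm.aestronglyMeasurable (hnorm hwr)
    (hnorm hzr) (b := (w - z) / r) (by rwa [hb]) (hmom hwr) (by simpa using hmom hzr)
    (g := fun ζ => (g (z + r * ζ) : ℂ)) (by fun_prop) (D := D)
    (fun x => by simpa using hD _)
  have h2 : ∀ X, z + r * ξ X = X (exitTime z r X) := fun X => by
    simp only [hξ]
    field_simp
    ring
  simp only [h2, hb] at h
  rwa [integral_complex_ofReal, integral_complex_ofReal, ← Complex.ofReal_sub, Complex.norm_real] at h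

lemma abs_resolventOp_sub_exit_le (hP : DefinesMTCBM P) (hPc : Continuous P) (hl : 0 < l)
    (hf : Continuous f) (hC : ∀ x, |f x| ≤ C) (w z : ℂ) (r : ℝ) (δ : ℝ≥0) :
    |resolventOp P l f w - ∫ X, resolventOp P l f (X (exitTime z r X)) ∂(P w : Measure PathSp)| ≤
      2 * (C / l) * (l * δ + (P w : Measure PathSp).real (exitBefore z r δ)ᶜ) := by
  have hg := continuous_resolventOp_of_continuous hPc hl hf hC
  have hCl : 0 ≤ C / l := (abs_nonneg _).trans (abs_resolventOp_le (P := P) hl hC 0)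
  set T := exitTime z r with hT
  have hMb : ∀ t X, |resolventMart P l f t X| ≤ 3 * (C / l) := by
    intro t X
    have h1 := abs_resolventMart_sub_le (P := P) hl hC t X
    have h2 := abs_resolventOp_le (P := P) hl hC (X t)
    have h3 := abs_sub_abs_le_abs_sub (resolventMart P l f t X) (resolventOp P l f (X t))
    nlinarith [Real.exp_pos (-(l * t))]
  have hGi : Integrable (discountedIntegral l f) (P w : Measure PathSp) :=
    Integrable.of_bound (measurable_discountedIntegral hf.measurable).aestronglyMeasurable _
      (Eventually.of_forall (abs_discountedIntegral_le hl hC))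
  have hN : ∀ N : ℕ, AEStronglyMeasurable (fun X => resolventMart P l f (min (T X) N) X)
      (P w : Measure PathSp) ∧ ∫ X, resolventMart P l f (min (T X) N) X ∂(P w : Measure PathSp) =
        ∫ X, discountedIntegral l f X ∂(P w : Measure PathSp) := fun N => integral_stopped_exit pastFiltration hGi N
    (fun t _ => resolventMart_ae_eq_condExp hP.2.1 hl hf hC hg w t)
    (Eventually.of_forall fun X => continuous_resolventMart hf hg X)
    (Y := fun t X => X t) (fun t => measurable_pastAlg_apply le_rfl)
    (Eventually.of_forall fun X => X.continuous) (hP.ae_isExitTime w z r)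
    (Eventually.of_forall fun X => hMb _ X)
  simp only [integral_discountedIntegral hl hf.measurable hC] at hN
  have hlim : ∀ᵐ X ∂(P w : Measure PathSp), Tendsto
      (fun N : ℕ => resolventMart P l f (min (T X) N) X) atTop (𝓝 (resolventMart P l f (T X) X)) := by
    refine Eventually.of_forall fun X => tendsto_const_nhds.congr' ?_
    filter_upwards [(tendsto_natCast_atTop_atTop (R := ℝ≥0)).eventually_ge_atTop (T X)] with N h
    rw [min_eq_left h]
  have hMT := tendsto_integral_of_dominated_convergence (fun _ => 3 * (C / l)) (fun N => (hN N).1)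
    (integrable_const _) (fun N => Eventually.of_forall fun X => hMb _ X) hlim
  have hMm := aestronglyMeasurable_of_tendsto_ae atTop (fun N => (hN N).1) hlim
  simp only [hN] at hMT
  have hgi : Integrable (fun X => resolventOp P l f (X (T X))) (P w : Measure PathSp) :=
    Integrable.of_bound (hg.measurable.comp (measurable_exitPoint z r)).aestronglyMeasurable (C / l)
      (Eventually.of_forall fun X => abs_resolventOp_le hl hC _)
  rw [tendsto_nhds_unique tendsto_const_nhds hMT, ← integral_sub (Integrable.of_bound hMm _
    (Eventually.of_forall fun X => hMb _ X)) hgi]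
  have hU := (isOpen_exitBefore z r δ).measurableSet.compl
  have hi : Integrable ((exitBefore z r δ)ᶜ.indicator fun _ => (1 : ℝ)) (P w : Measure PathSp) :=
    (integrable_const _).indicator hU
  refine (norm_integral_le_of_norm_le
    (f := fun X => resolventMart P l f (T X) X - resolventOp P l f (X (T X)))
    (g := fun X => 2 * (C / l) * (l * δ + (exitBefore z r δ)ᶜ.indicator (fun _ => (1 : ℝ)) X))
    (((integrable_const _).add hi).const_mul _) (Eventually.of_forall fun X => ?_)).trans
    (le_of_eq ?_)
  · refine (abs_resolventMart_sub_le hl hC _ X).trans ?_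
    gcongr
    by_cases hX : X ∈ exitBefore z r δ
    · have h1 := Real.add_one_le_exp (-(l * T X))
      have h2 : l * T X ≤ l * δ := by
        gcongr
        exact (exitTime_lt hX).le
      simp only [Set.indicator, Set.mem_compl_iff, hX, not_true_eq_false, if_false]
      linarith
    · simp only [Set.indicator, Set.mem_compl_iff, hX, not_false_eq_true, if_true]
      have : 0 ≤ l * (δ : ℝ) := by positivity
      linarith [Real.exp_pos (-(l * T X))]
  · rw [integral_const_mul, integral_add (integrable_const _) hi, integral_indicator hU]
    simp [Measure.real]

lemma exists_measure_exitBefore_compl_lt (hP : DefinesMTCBM P) (z : ℂ) {δ : ℝ≥0} (hδ : 0 < δ)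
    {ε : ℝ≥0∞} (hε : 0 < ε) :
    ∃ r > 0, (P z : Measure PathSp) (exitBefore z r δ)ᶜ < ε := by
  obtain ⟨Ω, _, μ, B, τ, F, h⟩ := hP.2.2 z
  have h1 : Tendsto (fun n : ℕ => (P z : Measure PathSp) (exitBefore z (1 / ((n : ℝ) + 1)) δ)ᶜ)
      atTop (𝓝 ((P z : Measure PathSp) (⋂ n : ℕ, (exitBefore z (1 / ((n : ℝ) + 1)) δ)ᶜ))) := by
    refine tendsto_measure_iInter_atTop
      (fun n => (isOpen_exitBefore z _ δ).measurableSet.compl.nullMeasurableSet) ?_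
      ⟨0, measure_ne_top _ _⟩
    refine fun m n hmn => Set.compl_subset_compl.2 ?_
    rintro X ⟨t, ht, hX⟩
    exact ⟨t, ht, lt_of_le_of_lt (one_div_le_one_div_of_le (by positivity) (by gcongr)) hX⟩
  have h2 : (P z : Measure PathSp) (⋂ n : ℕ, (exitBefore z (1 / ((n : ℝ) + 1)) δ)ᶜ) = 0 := by
    refine measure_mono_null ?_ (h.ae_exists_ne hδ)
    rintro X hX ⟨t, ht, h0⟩
    obtain ⟨n, hn⟩ := exists_nat_one_div_lt h0
    exact Set.mem_iInter.1 hX n ⟨t, ht, hn⟩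
  rw [h2] at h1
  obtain ⟨n, hn⟩ := (h1.eventually_lt_const hε).exists
  exact ⟨_, by positivity, hn⟩

/-- The resolvents of the continuous functions with a given bound are equicontinuous. -/
lemma eventually_abs_resolventOp_sub_le (hP : DefinesMTCBM P) (hPc : Continuous P) (hl : 0 < l)
    (hC0 : 0 ≤ C) (z : ℂ) {ε : ℝ} (hε : 0 < ε) :
    ∀ᶠ w in 𝓝 z, ∀ f : ℂ → ℝ, Continuous f → (∀ x, |f x| ≤ C) →
      |resolventOp P l f w - resolventOp P l f z| ≤ ε := by
  set D := C / l with hD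
  have hD0 : 0 ≤ D := by positivity
  set η := ε / (12 * (D + 1)) with hη
  have hη0 : 0 < η := by positivity
  obtain ⟨r, hr, hrz⟩ := exists_measure_exitBefore_compl_lt hP z (δ := (η / l).toNNReal)
    (by simp; positivity) (ENNReal.ofReal_pos.2 hη0)
  have hcl := ProbabilityMeasure.limsup_measure_closed_le_of_tendsto (hPc.tendsto z)
    (isOpen_exitBefore z r (η / l).toNNReal).isClosed_compl
  have hw1 := eventually_lt_of_limsup_lt (hcl.trans_lt hrz)
  have hw2 : ∀ᶠ w in 𝓝 z, ‖w - z‖ / r < min (1 / 2) η := by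
    have : Continuous fun w : ℂ => ‖w - z‖ / r := by fun_prop
    exact this.continuousAt.eventually (gt_mem_nhds (by simp [hη0]))
  filter_upwards [hw1, hw2] with w hw hwz f hf hfC
  have hg := continuous_resolventOp_of_continuous hPc hl hf hfC
  have hreal : ∀ {x : ℂ}, (P x : Measure PathSp) (exitBefore z r (η / l).toNNReal)ᶜ <
      ENNReal.ofReal η → (P x : Measure PathSp).real (exitBefore z r (η / l).toNNReal)ᶜ ≤ η :=
    fun h => ENNReal.toReal_le_of_le_ofReal hη0.le h.le
  have hδ : l * ((η / l).toNNReal : ℝ) = η := by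
    rw [Real.coe_toNNReal _ (by positivity)]
    field_simp
  have h1 := abs_resolventOp_sub_exit_le hP hPc hl hf hfC w z r (η / l).toNNReal
  have h2 := abs_resolventOp_sub_exit_le hP hPc hl hf hfC z z r (η / l).toNNReal
  have h3 := abs_integral_exit_sub_le hP hr (hwz.le.trans (min_le_left _ _)) hg
    (abs_resolventOp_le hl hfC)
  rw [hδ, ← hD] at h1 h2
  rw [← hD] at h3
  have h4 := mul_le_mul_of_nonneg_left (hreal hw) hD0
  have h5 := mul_le_mul_of_nonneg_left (hreal hrz) hD0
  have h6 := mul_le_mul_of_nonneg_left (hwz.le.trans (min_le_right _ _)) hD0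
  have h7 : 12 * (D * η) ≤ ε := by
    rw [hη]
    field_simp
    linarith
  rw [abs_le] at h1 h2 h3 ⊢
  constructor <;> nlinarith

end ExitLaw

lemma abs_integral_sub_le_of_continuous {μ ν : Measure ℂ} [IsFiniteMeasure μ] [IsFiniteMeasure ν]
    {C ε : ℝ} (h : ∀ f : ℂ → ℝ, Continuous f → (∀ x, |f x| ≤ C) →
      |∫ x, f x ∂μ - ∫ x, f x ∂ν| ≤ ε)
    {f : ℂ → ℝ} (hf : Measurable f) (hC : ∀ x, |f x| ≤ C) :
    |∫ x, f x ∂μ - ∫ x, f x ∂ν| ≤ ε := by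
  have hb : ∀ {κ : Measure ℂ} [IsFiniteMeasure κ] {φ : ℂ → ℝ}, Measurable φ →
      (∀ x, |φ x| ≤ C) → Integrable φ κ := fun h1 h2 =>
    Integrable.of_bound h1.aestronglyMeasurable C (Eventually.of_forall h2)
  refine le_of_forall_pos_le_add fun η hη => ?_
  obtain ⟨g, hg, hgi⟩ := (hb hf hC (κ := μ + ν)).exists_boundedContinuous_integral_sub_le hη
  set g' : ℂ → ℝ := fun x => max (-C) (min C (g x)) with hg'
  have hC0 : 0 ≤ C := (abs_nonneg _).trans (hC 0)
  have hg'c : Continuous g' := continuous_const.max (continuous_const.min g.continuous)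
  have hg'C : ∀ x, |g' x| ≤ C := fun x =>
    abs_le.2 ⟨le_max_left _ _, max_le (by linarith) (min_le_left _ _)⟩
  have hle : ∀ x, |f x - g' x| ≤ ‖f x - g x‖ := by
    intro x
    have h1 : f x = max (-C) (min C (f x)) := by
      rw [min_eq_right (abs_le.1 (hC x)).2, max_eq_right (abs_le.1 (hC x)).1]
    calc |f x - g' x| = |max (-C) (min C (f x)) - max (-C) (min C (g x))| := by rw [← h1]
      _ ≤ |min C (f x) - min C (g x)| := by
          simpa using abs_max_sub_max_le_max (-C) (min C (f x)) (-C) (min C (g x))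
      _ ≤ |f x - g x| := by simpa using abs_min_sub_min_le_max C (f x) C (g x)
  have h_int : ∀ {κ : Measure ℂ} [IsFiniteMeasure κ],
      Integrable (fun x => |f x - g' x|) κ :=
    fun {κ} _ => ((hb hf hC).sub (hb hg'c.measurable hg'C)).abs
  have hdiff : ∀ {κ : Measure ℂ} [IsFiniteMeasure κ],
      |∫ x, f x ∂κ - ∫ x, g' x ∂κ| ≤ ∫ x, |f x - g' x| ∂κ := by
    intro κ _
    rw [← integral_sub (hb hf hC) (hb hg'c.measurable hg'C)]
    exact abs_integral_le_integral_abs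
  have hsum : ∫ x, |f x - g' x| ∂μ + ∫ x, |f x - g' x| ∂ν ≤ η := by
    rw [← integral_add_measure h_int h_int]
    exact (integral_mono h_int ((hb hf hC).sub hgi).norm hle).trans hg
  have h1 := h g' hg'c hg'C
  have h2 := hdiff (κ := μ)
  have h3 := hdiff (κ := ν)
  rw [abs_le] at h1 h2 h3 ⊢
  constructor <;> linarith

/-- The resolvent is integration against a finite kernel. -/
lemma exists_measure_resolventOp_eq (P : ℂ → ProbabilityMeasure PathSp) {l : ℝ} (hl : 0 < l)
    (z : ℂ) : ∃ κ : Measure ℂ, IsFiniteMeasure κ ∧ ∀ f : ℂ → ℝ, Measurable f →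
      ∀ C, (∀ x, |f x| ≤ C) → resolventOp P l f z = ∫ x, f x ∂κ := by
  set π := (P z : Measure PathSp).prod (volume.restrict (Set.Ioi (0 : ℝ)))
  set ρ : PathSp × ℝ → ℝ := fun p => Real.exp (-(l * p.2))
  have hρ : Measurable ρ := by fun_prop
  have hφ : Measurable fun p : PathSp × ℝ => p.1 p.2.toNNReal :=
    measurable_path_eval.comp (measurable_fst.prodMk (measurable_real_toNNReal.comp measurable_snd))
  have hρi : Integrable ρ π := (integrableOn_exp_neg_mul hl).comp_snd _
  have := isFiniteMeasure_withDensity_ofReal hρi.2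
  refine ⟨(π.withDensity fun p => ENNReal.ofReal (ρ p)).map fun p => p.1 p.2.toNNReal,
    inferInstance, fun f hf C hC => ?_⟩
  rw [integral_map hφ.aemeasurable hf.aestronglyMeasurable,
    integral_withDensity_eq_integral_toReal_smul hρ.ennreal_ofReal
      (Eventually.of_forall fun _ => ENNReal.ofReal_lt_top)]
  have h1 : ∀ p, (ENNReal.ofReal (ρ p)).toReal = ρ p := fun p =>
    ENNReal.toReal_ofReal (Real.exp_pos _).le
  simp only [h1, smul_eq_mul]
  rw [integral_prod _ (integrable_discounted_prod hl hf hC _),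
    ← integral_discountedIntegral hl hf hC]
  rfl

theorem stmt14 (P : ℂ → ProbabilityMeasure PathSp) (hPc : Continuous P)
    (hP : DefinesMTCBM P) (l : ℝ) (hl : 0 < l) (f : ℂ → ℝ)
    (hf : Measurable f) (hfb : ∃ C : ℝ, ∀ x, |f x| ≤ C) :
    Continuous (resolventOp P l f) := by
  obtain ⟨C, hC⟩ := hfb
  have hC0 : 0 ≤ C := (abs_nonneg _).trans (hC 0)
  refine continuous_iff_continuousAt.2 fun z => Metric.tendsto_nhds.2 fun ε hε => ?_
  filter_upwards [eventually_abs_resolventOp_sub_le hP hPc hl hC0 z (half_pos hε)] with w hw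
  obtain ⟨κw, _, hκw⟩ := exists_measure_resolventOp_eq P hl w
  obtain ⟨κz, _, hκz⟩ := exists_measure_resolventOp_eq P hl z
  refine lt_of_le_of_lt ?_ (half_lt_self hε)
  rw [Real.dist_eq, hκw f hf C hC, hκz f hf C hC]
  refine abs_integral_sub_le_of_continuous (fun g hg hgC => ?_) hf hC
  rw [← hκw g hg.measurable C hgC, ← hκz g hg.measurable C hgC]
  exact hw g hg hgC
end
end
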